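/- Let E = (E^0, E^1, r, s) be a totally disconnected topological graph which is topologically free and cofinal (equivalently, by Katsura's simplicity theorem, the topological graph algebra O(E) is simple). Suppose there exists a cycle μ with entrances such that every open neighborhood N of μ in E^{|μ|} contains an open neighborhood U of μ with r^{|μ|}(U) ⊆ s^{|μ|}(U). Then E is essentially free (the units of the boundary path groupoid Γ(∂E, σ) with trivial isotropy are dense in ∂E) and the boundary path groupoid Γ(∂E, σ) is locally contracting. -/

import Mathlib

/-- A locally compact Hausdorff space is *totally disconnected* (in the sense used for
topological graphs) if it has an open base consisting of compact open subsets. -/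
def TotallyDisc (T : Type) [TopologicalSpace T] : Prop :=
  ∀ (t : T) (U : Set T), IsOpen U → t ∈ U →
    ∃ W : Set T, IsCompact W ∧ IsOpen W ∧ t ∈ W ∧ W ⊆ U

/-- A topological graph `E = (E⁰, E¹, r, s)`: `r` continuous, `s` a local homeomorphism. -/
structure TopGraph (V E : Type) [TopologicalSpace V] [TopologicalSpace E] where
  r : E → V
  s : E → V
  cont_r : Continuous r
  locHomeo_s : IsLocalHomeomorph s

namespace TopGraph

variable {V E : Type} [TopologicalSpace V] [TopologicalSpace E] (G : TopGraph V E)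

/-- Compatibility condition for a finite sequence of edges to be a path. -/
def PathCond (n : ℕ) (μ : Fin n → E) : Prop :=
  ∀ (i : ℕ) (h : i + 1 < n), G.s (μ ⟨i, Nat.lt_of_succ_lt h⟩) = G.r (μ ⟨i + 1, h⟩)

/-- The space `Eⁿ` of paths of length `n`; paths of length `0` are vertices. -/
def PathN : ℕ → Type
  | 0 => V
  | n + 1 => { μ : Fin (n + 1) → E // G.PathCond (n + 1) μ }

instance pathNTop : (n : ℕ) → TopologicalSpace (G.PathN n)
  | 0 => inferInstanceAs (TopologicalSpace V)
  | n + 1 => inferInstanceAs (TopologicalSpace { μ : Fin (n + 1) → E // G.PathCond (n + 1) μ })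

/-- The finite path space `E* = ⨿ₙ Eⁿ` with the disjoint union topology. -/
def FinPath : Type := (n : ℕ) × G.PathN n

instance : TopologicalSpace G.FinPath := inferInstanceAs (TopologicalSpace ((n : ℕ) × G.PathN n))

/-- The range `r(μ)` of a finite path. -/
def pathRange : (n : ℕ) → G.PathN n → V
  | 0, v => v
  | _ + 1, μ => G.r (μ.1 ⟨0, Nat.succ_pos _⟩)

/-- The source `s(μ)` of a finite path. -/
def pathSource : (n : ℕ) → G.PathN n → V
  | 0, v => v
  | n + 1, μ => G.s (μ.1 ⟨n, Nat.lt_succ_self n⟩)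

/-- The `i`-th edge of a finite path (`none` if out of range); `0`-indexed. -/
def pathEdge : (n : ℕ) → G.PathN n → ℕ → Option E
  | 0, _, _ => none
  | n + 1, μ, i => if h : i < n + 1 then some (μ.1 ⟨i, h⟩) else none

/-- `E⁰_sce = E⁰ \ cl (r(E¹))`. -/
def sce : Set V := {v | v ∉ closure (Set.range G.r)}

/-- `E⁰_fin`: vertices with an open neighborhood `N` such that `r⁻¹(cl N)` is compact. -/
def finV : Set V := {v | ∃ N : Set V, IsOpen N ∧ v ∈ N ∧ IsCompact (G.r ⁻¹' closure N)}

/-- `E⁰_rg = E⁰_fin \ cl (E⁰_sce)`. -/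
def rg : Set V := G.finV \ closure G.sce

/-- `E⁰_sg = E⁰ \ E⁰_rg`. -/
def sg : Set V := {v | v ∉ G.rg}

/-- The infinite path space `E^∞`. -/
def InfPath : Type := { μ : ℕ → E // ∀ i : ℕ, G.s (μ i) = G.r (μ (i + 1)) }

/-- The boundary path space `∂E = E^∞ ⨿ {μ ∈ E* : s(μ) ∈ E⁰_sg}`. -/
def BoundaryPath : Type :=
  G.InfPath ⊕ { α : G.FinPath // G.pathSource α.1 α.2 ∈ G.sg }

/-- The finite boundary path determined by a finite path whose source is singular. -/
def mkFin (α : G.FinPath) (h : G.pathSource α.1 α.2 ∈ G.sg) : G.BoundaryPath :=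
  Sum.inr ⟨α, h⟩

/-- The length of a boundary path, in `ℕ∞`. -/
def bLen : G.BoundaryPath → ℕ∞
  | Sum.inl _ => ⊤
  | Sum.inr α => (α.1.1 : ℕ∞)

/-- The `i`-th edge of a boundary path. -/
def bEdge : G.BoundaryPath → ℕ → Option E
  | Sum.inl μ, i => some (μ.1 i)
  | Sum.inr α, i => G.pathEdge α.1.1 α.1.2 i

/-- The range vertex of a boundary path. -/
def bRange : G.BoundaryPath → V
  | Sum.inl μ => G.r (μ.1 0)
  | Sum.inr α => G.pathRange α.1.1 α.1.2

/-- `α ∈ E*` is an initial segment of the boundary path `μ`, i.e. `μ = αβ`. -/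
def IsPrefix (α : G.FinPath) (μ : G.BoundaryPath) : Prop :=
  G.pathRange α.1 α.2 = G.bRange μ ∧
    ∀ i : ℕ, i < α.1 → G.bEdge μ i = G.pathEdge α.1 α.2 i

/-- The cylinder set `Z(S) ⊆ ∂E` of a set `S ⊆ E*`. -/
def cyl (S : Set G.FinPath) : Set G.BoundaryPath :=
  {μ | ∃ α ∈ S, G.IsPrefix α μ}

/-- The topology on `∂E`, generated by the sets `Z(U) ∩ Z(K)ᶜ` with `U` open, `K` compact. -/
instance : TopologicalSpace G.BoundaryPath :=
  TopologicalSpace.generateFrom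
    {W | ∃ (U K : Set G.FinPath), IsOpen U ∧ IsCompact K ∧ W = G.cyl U ∩ (G.cyl K)ᶜ}

/-- Removing the first edge of a path of length `n + 1`. -/
def pathTail : (n : ℕ) → G.PathN (n + 1) → G.PathN n
  | 0, μ => G.s (μ.1 ⟨0, Nat.one_pos⟩)
  | n + 1, μ => ⟨fun i => μ.1 ⟨i.1 + 1, by omega⟩, fun i h => μ.2 (i + 1) (by omega)⟩

theorem pathSource_pathTail : ∀ (n : ℕ) (μ : G.PathN (n + 1)),
    G.pathSource n (G.pathTail n μ) = G.pathSource (n + 1) μ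
  | 0, μ => rfl
  | n + 1, μ => rfl

/-- The one-sided shift `σ` on `∂E` (the identity on paths of length `0`,
where it is undefined). -/
def shift : G.BoundaryPath → G.BoundaryPath
  | Sum.inl μ => Sum.inl ⟨fun i => μ.1 (i + 1), fun i => μ.2 (i + 1)⟩
  | Sum.inr α =>
    match α with
    | ⟨⟨0, v⟩, h⟩ => Sum.inr ⟨⟨0, v⟩, h⟩
    | ⟨⟨n + 1, μ⟩, h⟩ =>
        Sum.inr ⟨⟨n, G.pathTail n μ⟩, by rw [G.pathSource_pathTail]; exact h⟩

/-- The Renault–Deaconu relation of the boundary path groupoid `Γ(∂E, σ)`: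
`(μ, n, ν)` is an element of the groupoid. -/
def bRD (μ : G.BoundaryPath) (n : ℤ) (ν : G.BoundaryPath) : Prop :=
  ∃ k l : ℕ, n = (k : ℤ) - (l : ℤ) ∧ (k : ℕ∞) ≤ G.bLen μ ∧ (l : ℕ∞) ≤ G.bLen ν ∧
    G.shift^[k] μ = G.shift^[l] ν

/-- The boundary path groupoid `Γ(∂E, σ)` as a set of triples. -/
def BPGroupoid : Type :=
  { x : G.BoundaryPath × ℤ × G.BoundaryPath // G.bRD x.1 x.2.1 x.2.2 }

/-- The range map of the boundary path groupoid. -/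
def gR (x : G.BPGroupoid) : G.BoundaryPath := x.1.1

/-- The source map of the boundary path groupoid. -/
def gS (x : G.BPGroupoid) : G.BoundaryPath := x.1.2.2

/-- The topology on `Γ(∂E, σ)` generated by the basic open sets `𝒰(U, V, k, l)`. -/
instance : TopologicalSpace G.BPGroupoid :=
  TopologicalSpace.generateFrom
    {W | ∃ (U Vs : Set G.BoundaryPath) (k l : ℕ),
      IsOpen U ∧ IsOpen Vs ∧
      (∀ μ ∈ U, (k : ℕ∞) ≤ G.bLen μ) ∧ (∀ μ ∈ Vs, (l : ℕ∞) ≤ G.bLen μ) ∧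
      Set.InjOn (G.shift^[k]) U ∧ Set.InjOn (G.shift^[l]) Vs ∧
      W = {x : G.BPGroupoid | G.gR x ∈ U ∧ G.gS x ∈ Vs ∧ x.1.2.1 = (k : ℤ) - (l : ℤ) ∧
        G.shift^[k] (G.gR x) = G.shift^[l] (G.gS x)}}

/-- A unit `μ ∈ ∂E` has trivial isotropy in `Γ(∂E, σ)`. -/
def TrivialIsotropy (μ : G.BoundaryPath) : Prop :=
  ∀ n : ℤ, G.bRD μ n μ → n = 0

/-- `E` is essentially free: the units with trivial isotropy are dense in `∂E`. -/
def EssentiallyFree : Prop := Dense {μ : G.BoundaryPath | G.TrivialIsotropy μ}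

/-- `N ⊆ Γ(∂E, σ)` is a bisection: the source and range maps restrict to homeomorphisms
of `N` onto their images. -/
def IsBisection (N : Set G.BPGroupoid) : Prop :=
  Topology.IsEmbedding (N.restrict G.gS) ∧ Topology.IsEmbedding (N.restrict G.gR)

/-- The boundary path groupoid `Γ(∂E, σ)` is locally contracting
(Anantharaman-Delaroche): for every nonempty open `U` in the unit space `∂E` there are an
open `V ⊆ U` and an open bisection `N` with `cl V ⊆ s(N)` and
`s((r|_{N⁻¹})⁻¹(cl V)) ⊊ V`. -/
def BPLocallyContracting : Prop :=
  ∀ U : Set G.BoundaryPath, IsOpen U → U.Nonempty →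
    ∃ (Vs : Set G.BoundaryPath) (N : Set G.BPGroupoid),
      IsOpen Vs ∧ Vs ⊆ U ∧ IsOpen N ∧ G.IsBisection N ∧
      closure Vs ⊆ G.gS '' N ∧
      G.gR '' (N ∩ {x | G.gS x ∈ closure Vs}) ⊂ Vs

/-- `μ` is a cycle: a path of length `n + 1 ≥ 1` with `r(μ) = s(μ)`. -/
def IsCycle (n : ℕ) (μ : G.PathN (n + 1)) : Prop :=
  G.pathRange (n + 1) μ = G.pathSource (n + 1) μ

/-- The cycle `μ` has no entrances: `r⁻¹(r(μᵢ)) = {μᵢ}` for all `i`. -/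
def NoEntrances (n : ℕ) (μ : G.PathN (n + 1)) : Prop :=
  ∀ (i : Fin (n + 1)) (e : E), G.r e = G.r (μ.1 i) → e = μ.1 i

/-- The cycle `μ` has entrances. -/
def HasEntrances (n : ℕ) (μ : G.PathN (n + 1)) : Prop := ¬ G.NoEntrances n μ

/-- `E` is topologically free: the set of base points of cycles without entrances has
empty interior. -/
def TopologicallyFree : Prop :=
  interior {v : V | ∃ (n : ℕ) (μ : G.PathN (n + 1)),
    G.IsCycle n μ ∧ G.NoEntrances n μ ∧ G.pathRange (n + 1) μ = v} = ∅

/-- The positive orbit space `Orb⁺(v)` of a vertex. -/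
def orb (v : V) : Set V :=
  {w | ∃ (n : ℕ) (ν : G.PathN n), G.pathRange n ν = w ∧ G.pathSource n ν = v}

/-- `Orb⁺(r(μ)) ∪ ⋃ᵢ Orb⁺(s(μᵢ))` for a boundary path `μ`. -/
def cofinalSet (μ : G.BoundaryPath) : Set V :=
  G.orb (G.bRange μ) ∪ {w | ∃ (i : ℕ) (e : E), G.bEdge μ i = some e ∧ w ∈ G.orb (G.s e)}

/-- `E` is cofinal. -/
def Cofinal : Prop := ∀ μ : G.BoundaryPath, Dense (G.cofinalSet μ)

/-- Every open neighborhood `N` of `μ` in `E^{|μ|}` contains an open neighborhood `U` of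
`μ` with `r^{|μ|}(U) ⊆ s^{|μ|}(U)`. -/
def NbhdContracting (n : ℕ) (μ : G.PathN (n + 1)) : Prop :=
  ∀ N : Set (G.PathN (n + 1)), IsOpen N → μ ∈ N →
    ∃ U : Set (G.PathN (n + 1)), IsOpen U ∧ μ ∈ U ∧ U ⊆ N ∧
      G.pathRange (n + 1) '' U ⊆ G.pathSource (n + 1) '' U

/-- The set `B` of vertices which connect to a cycle `μ` with entrances such that every
open neighborhood of `μ` contains an open neighborhood `U` of `μ` with
`r^{|μ|}(U) ⊆ s^{|μ|}(U)`. -/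
def Bset : Set V :=
  {v | ∃ (n : ℕ) (μ : G.PathN (n + 1)), G.IsCycle n μ ∧ G.HasEntrances n μ ∧
    v ∈ G.orb (G.pathRange (n + 1) μ) ∧ G.NbhdContracting n μ}

/-- Truncation of a path of length `n + 1` to its first `m + 1` edges (`m ≤ n`). -/
def pathTrunc (m n : ℕ) (h : m ≤ n) (μ : G.PathN (n + 1)) : G.PathN (m + 1) :=
  ⟨fun i => μ.1 ⟨i.1, by omega⟩, fun i hi => μ.2 i (by omega)⟩

/-- The conditions on a finite family `{Uᵢ ⊆ E^{nᵢ+1}}` witnessing that `Vset` is a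
contracting open set in the sense of Katsura. -/
def ContractingWitness (Vset : Set V) (k : ℕ) (nf : Fin k → ℕ)
    (U : ∀ i : Fin k, Set (G.PathN (nf i + 1))) : Prop :=
  (∀ i, (U i).Nonempty ∧ IsOpen (U i)) ∧
  (∀ i, ∀ μ ∈ U i, G.pathRange (nf i + 1) μ ∈ Vset) ∧
  (∀ i j, i ≠ j → ∀ h : nf i ≤ nf j, ∀ μ ∈ U j, G.pathTrunc (nf i) (nf j) h μ ∉ U i) ∧
  closure Vset ⊂ ⋃ i, (G.pathSource (nf i + 1)) '' U i

/-- `Vset ⊆ E⁰` is a contracting open set in the sense of Katsura. -/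
def IsContractingSet (Vset : Set V) : Prop :=
  Vset.Nonempty ∧ IsOpen Vset ∧ IsCompact (closure Vset) ∧
    ∃ (k : ℕ) (nf : Fin k → ℕ) (U : ∀ i : Fin k, Set (G.PathN (nf i + 1))),
      G.ContractingWitness Vset k nf U

/-- `E` is contracting at the vertex `v`. -/
def ContractingAt (v : V) : Prop :=
  Dense (G.orb v) ∧ ∀ N : Set V, IsOpen N → v ∈ N →
    ∃ W : Set V, W ⊆ N ∧ G.IsContractingSet W

/-- `E` is a contracting topological graph. -/
def Contracting : Prop := ∃ v : V, G.ContractingAt v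

end TopGraph

namespace TopGraph

open Set Filter Topology

section

variable {V E : Type} [TopologicalSpace V] [TopologicalSpace E] {G : TopGraph V E}

/-! ### Finite paths -/

/-- The first edge of a path of positive length. -/
def firstEdge {n : ℕ} (α : G.PathN (n + 1)) : E := α.1 ⟨0, Nat.succ_pos _⟩

theorem s_firstEdge : ∀ {n : ℕ} (α : G.PathN (n + 1)),
    G.s (firstEdge α) = G.pathRange n (G.pathTail n α)
  | 0, _ => rfl
  | _ + 1, α => α.2 0 (by omega)

theorem exists_cons : ∀ {n : ℕ} (e : E) (β : G.PathN n), G.s e = G.pathRange n β →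
    ∃ α : G.PathN (n + 1), firstEdge α = e ∧ G.pathTail n α = β
  | 0, e, _, h => ⟨⟨fun _ => e, fun i hi => absurd (Nat.lt_of_succ_lt_succ hi) (Nat.not_lt_zero i)⟩, rfl, h⟩
  | n + 1, e, β, h => by
    refine ⟨⟨Fin.cons e β.1, ?_⟩, rfl, rfl⟩
    intro i hi
    cases i with
    | zero => exact h
    | succ i => exact β.2 i (by omega)

theorem pathN_ext : ∀ {n : ℕ} {α β : G.PathN (n + 1)},
    firstEdge α = firstEdge β → G.pathTail n α = G.pathTail n β → α = β
  | 0, α, β, h, _ => by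
    apply Subtype.ext
    funext i
    obtain rfl : i = ⟨0, Nat.succ_pos _⟩ := Fin.ext (Nat.lt_one_iff.1 i.2)
    exact h
  | n + 1, α, β, h, h' => by
    apply Subtype.ext
    funext i
    refine Fin.cases h (fun j => ?_) i
    exact congrFun (congrArg Subtype.val h') j

theorem pathEdge_succ {n : ℕ} (α : G.PathN (n + 1)) (i : ℕ) :
    G.pathEdge (n + 1) α (i + 1) = G.pathEdge n (G.pathTail n α) i := by
  cases n with
  | zero => simp [pathEdge]
  | succ n => simp [pathEdge, pathTail]

theorem pathEdge_zero {n : ℕ} (α : G.PathN (n + 1)) :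
    G.pathEdge (n + 1) α 0 = some (firstEdge α) := by
  simp [pathEdge, firstEdge]

theorem pathEdge_ne_none {n i : ℕ} (α : G.PathN n) : G.pathEdge n α i ≠ none ↔ i < n := by
  cases n with
  | zero => simp [pathEdge]
  | succ n => simp [pathEdge]

theorem pathEdge_self {n : ℕ} (α : G.PathN n) : G.pathEdge n α n = none := by
  by_contra h
  exact lt_irrefl _ ((pathEdge_ne_none α).1 h)

/-! ### Boundary paths -/

theorem bEdge_shift (x : G.BoundaryPath) (i : ℕ) :
    G.bEdge (G.shift x) i = G.bEdge x (i + 1) := by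
  match x with
  | Sum.inl μ => rfl
  | Sum.inr ⟨⟨0, v⟩, h⟩ => rfl
  | Sum.inr ⟨⟨n + 1, α⟩, h⟩ => exact (pathEdge_succ α i).symm

theorem bEdge_shift_iter (k : ℕ) (x : G.BoundaryPath) (i : ℕ) :
    G.bEdge (G.shift^[k] x) i = G.bEdge x (k + i) := by
  induction k generalizing x with
  | zero => simp
  | succ k ih => rw [Function.iterate_succ_apply, ih, bEdge_shift]; congr 1; omega

theorem le_bLen_iff {k : ℕ} {x : G.BoundaryPath} :
    (k : ℕ∞) ≤ G.bLen x ↔ ∀ i < k, G.bEdge x i ≠ none := by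
  match x with
  | Sum.inl μ => simp [bLen, bEdge]
  | Sum.inr α =>
    simp only [bLen, bEdge, pathEdge_ne_none, Nat.cast_le]
    exact ⟨fun h i hi => hi.trans_le h, fun h => not_lt.1 fun h' => lt_irrefl _ (h _ h')⟩

theorem bEdge_ne_none_of_le {x : G.BoundaryPath} {i j : ℕ} (h : i ≤ j)
    (hj : G.bEdge x j ≠ none) : G.bEdge x i ≠ none := by
  match x with
  | Sum.inl μ => simp [bEdge]
  | Sum.inr α =>
    simp only [bEdge, pathEdge_ne_none] at *
    omega

theorem le_bLen_mono {k l : ℕ} {x : G.BoundaryPath} (h : k ≤ l) (hl : (l : ℕ∞) ≤ G.bLen x) :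
    (k : ℕ∞) ≤ G.bLen x := le_trans (by exact_mod_cast h) hl

theorem succ_le_bLen_iff {k : ℕ} {x : G.BoundaryPath} :
    ((k + 1 : ℕ) : ℕ∞) ≤ G.bLen x ↔ G.bEdge x k ≠ none := by
  rw [le_bLen_iff]
  exact ⟨fun h => h k k.lt_succ_self,
    fun h i hi => bEdge_ne_none_of_le (Nat.lt_succ_iff.1 hi) h⟩

theorem add_le_bLen_iff {k l : ℕ} {x : G.BoundaryPath} :
    ((k + l : ℕ) : ℕ∞) ≤ G.bLen x ↔
      (k : ℕ∞) ≤ G.bLen x ∧ (l : ℕ∞) ≤ G.bLen (G.shift^[k] x) := by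
  simp only [le_bLen_iff, bEdge_shift_iter]
  refine ⟨fun h => ⟨fun i hi => h i (by omega), fun i hi => h _ (by omega)⟩, fun h i hi => ?_⟩
  by_cases hk : i < k
  · exact h.1 i hk
  · have := h.2 (i - k) (by omega)
    rwa [Nat.add_sub_cancel' (by omega)] at this

theorem bRange_of_bEdge_zero {x : G.BoundaryPath} {e : E} (h : G.bEdge x 0 = some e) :
    G.bRange x = G.r e := by
  match x with
  | Sum.inl μ => exact congrArg G.r (Option.some.inj h)
  | Sum.inr ⟨⟨0, v⟩, hv⟩ => exact absurd h (by simp [bEdge, pathEdge])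
  | Sum.inr ⟨⟨n + 1, α⟩, hα⟩ =>
    exact congrArg G.r (Option.some.inj ((pathEdge_zero α).symm.trans h))

theorem bRange_shift {x : G.BoundaryPath} {e : E} (h : G.bEdge x 0 = some e) :
    G.bRange (G.shift x) = G.s e := by
  match x with
  | Sum.inl μ => exact (μ.2 0).symm.trans (congrArg G.s (Option.some.inj h))
  | Sum.inr ⟨⟨0, v⟩, hv⟩ => exact absurd h (by simp [bEdge, pathEdge])
  | Sum.inr ⟨⟨n + 1, α⟩, hα⟩ =>
    exact (s_firstEdge α).symm.trans
      (congrArg G.s (Option.some.inj ((pathEdge_zero α).symm.trans h)))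

theorem bRange_shift_iter {x : G.BoundaryPath} {i : ℕ} {e : E} (h : G.bEdge x i = some e) :
    G.bRange (G.shift^[i] x) = G.r e := by
  apply bRange_of_bEdge_zero
  rw [bEdge_shift_iter]; exact h

theorem bRange_shift_iter_succ {x : G.BoundaryPath} {i : ℕ} {e : E} (h : G.bEdge x i = some e) :
    G.bRange (G.shift^[i + 1] x) = G.s e := by
  rw [Function.iterate_succ_apply']
  apply bRange_shift
  rw [bEdge_shift_iter]; exact h

theorem boundaryPath_eq_of_length_zero {x : G.BoundaryPath} (h : G.bEdge x 0 = none) :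
    ∃ hs : G.bRange x ∈ G.sg, x = Sum.inr ⟨⟨0, G.bRange x⟩, hs⟩ := by
  match x with
  | Sum.inl μ => exact absurd h (by simp [bEdge])
  | Sum.inr ⟨⟨0, v⟩, hv⟩ => exact ⟨hv, rfl⟩
  | Sum.inr ⟨⟨n + 1, α⟩, hα⟩ =>
    exact absurd ((pathEdge_zero α).symm.trans h) (by simp)

theorem pathN_ext_edge : ∀ {n : ℕ} {α β : G.PathN n}, G.pathRange n α = G.pathRange n β →
    (∀ i < n, G.pathEdge n α i = G.pathEdge n β i) → α = β
  | 0, _, _, h, _ => h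
  | n + 1, α, β, _, h => by
    have h0 := h 0 (Nat.succ_pos _)
    rw [pathEdge_zero, pathEdge_zero, Option.some_inj] at h0
    refine pathN_ext h0 (pathN_ext_edge ?_ fun i hi => ?_)
    · rw [← s_firstEdge, ← s_firstEdge, h0]
    · rw [← pathEdge_succ, ← pathEdge_succ]; exact h _ (by omega)

theorem boundaryPath_ext {x y : G.BoundaryPath} (hr : G.bRange x = G.bRange y)
    (he : ∀ i, G.bEdge x i = G.bEdge y i) : x = y := by
  match x, y with
  | Sum.inl μ, Sum.inl ν =>
    exact congrArg Sum.inl (Subtype.ext (funext fun i => Option.some.inj (he i)))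
  | Sum.inl μ, Sum.inr ⟨⟨n, β⟩, hβ⟩ =>
    have h := he n
    rw [show G.bEdge (Sum.inr ⟨⟨n, β⟩, hβ⟩) n = none from pathEdge_self β] at h
    exact absurd h (by simp [bEdge])
  | Sum.inr ⟨⟨n, β⟩, hβ⟩, Sum.inl μ =>
    have h := he n
    rw [show G.bEdge (Sum.inr ⟨⟨n, β⟩, hβ⟩) n = none from pathEdge_self β] at h
    exact absurd h.symm (by simp [bEdge])
  | Sum.inr ⟨⟨n, α⟩, hα⟩, Sum.inr ⟨⟨m, β⟩, hβ⟩ =>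
    have hnm : n = m := by
      have h1 : ∀ i, i < n ↔ i < m := fun i => by
        rw [← pathEdge_ne_none α, ← pathEdge_ne_none β]
        exact not_congr (by rw [show G.pathEdge n α i = G.pathEdge m β i from he i])
      have := h1 n; have := h1 m; omega
    subst hnm
    obtain rfl : α = β := pathN_ext_edge hr fun i _ => he i
    rfl

theorem exists_cons_boundaryPath (e : E) (y : G.BoundaryPath) (h : G.s e = G.bRange y) :
    ∃ x : G.BoundaryPath, G.bEdge x 0 = some e ∧ G.shift x = y := by
  match y, h with
  | Sum.inl μ, h =>
    refine ⟨Sum.inl ⟨fun i => Nat.casesOn i e μ.1, fun i => ?_⟩, rfl, rfl⟩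
    cases i with
    | zero => exact h
    | succ i => exact μ.2 i
  | Sum.inr ⟨⟨n, β⟩, hβ⟩, h =>
    obtain ⟨α, rfl, rfl⟩ := exists_cons e β h
    exact ⟨Sum.inr ⟨⟨n + 1, α⟩, by rw [← G.pathSource_pathTail]; exact hβ⟩, pathEdge_zero α, rfl⟩

theorem shift_eq_imp_eq {x y : G.BoundaryPath} {e : E} (hx : G.bEdge x 0 = some e)
    (hy : G.bEdge y 0 = some e) (h : G.shift x = G.shift y) : x = y := by
  apply boundaryPath_ext
  · rw [bRange_of_bEdge_zero hx, bRange_of_bEdge_zero hy]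
  · intro i
    cases i with
    | zero => rw [hx, hy]
    | succ i => rw [← bEdge_shift, h, bEdge_shift]

/-! ### Prefixes -/

theorem isPrefix_zero {v : G.PathN 0} {x : G.BoundaryPath} :
    G.IsPrefix ⟨0, v⟩ x ↔ G.pathRange 0 v = G.bRange x := by
  simp [IsPrefix]

theorem isPrefix_succ {n : ℕ} {α : G.PathN (n + 1)} {x : G.BoundaryPath} :
    G.IsPrefix ⟨n + 1, α⟩ x ↔
      G.bEdge x 0 = some (firstEdge α) ∧ G.IsPrefix ⟨n, G.pathTail n α⟩ (G.shift x) := by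
  simp only [IsPrefix, bEdge_shift]
  constructor
  · rintro ⟨h1, h2⟩
    have h0 := (h2 0 (Nat.succ_pos _)).trans (pathEdge_zero α)
    refine ⟨h0, ?_, fun i hi => ?_⟩
    · rw [bRange_shift h0, s_firstEdge]
    · rw [h2 _ (by omega), pathEdge_succ]
  · rintro ⟨h0, -, h2⟩
    refine ⟨(bRange_of_bEdge_zero h0).symm, fun i hi => ?_⟩
    cases i with
    | zero => rw [h0, pathEdge_zero]
    | succ i => rw [h2 i (by omega), pathEdge_succ]

theorem IsPrefix.le_bLen {n : ℕ} {α : G.PathN n} {x : G.BoundaryPath}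
    (h : G.IsPrefix ⟨n, α⟩ x) : (n : ℕ∞) ≤ G.bLen x := by
  rw [le_bLen_iff]
  intro i hi
  rw [h.2 i hi]
  exact (pathEdge_ne_none α).2 hi

theorem IsPrefix.eq {n : ℕ} {α β : G.PathN n} {x : G.BoundaryPath}
    (h : G.IsPrefix ⟨n, α⟩ x) (h' : G.IsPrefix ⟨n, β⟩ x) : α = β :=
  pathN_ext_edge (h.1.trans h'.1.symm) fun i hi => (h.2 i hi).symm.trans (h'.2 i hi)

theorem exists_isPrefix {n : ℕ} {x : G.BoundaryPath} (h : (n : ℕ∞) ≤ G.bLen x) :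
    ∃ α : G.PathN n, G.IsPrefix ⟨n, α⟩ x := by
  induction n generalizing x with
  | zero => exact ⟨(G.bRange x : V), isPrefix_zero.2 rfl⟩
  | succ n ih =>
    rw [add_comm] at h
    have h' := add_le_bLen_iff.1 h
    obtain ⟨β, hβ⟩ := ih h'.2
    obtain ⟨e, he⟩ := Option.ne_none_iff_exists'.1 (le_bLen_iff.1 h'.1 0 Nat.one_pos)
    obtain ⟨α, rfl, rfl⟩ := exists_cons e β (by rw [← bRange_shift he]; exact hβ.1.symm)
    exact ⟨α, isPrefix_succ.2 ⟨he, hβ⟩⟩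

theorem IsPrefix.pathSource_eq {n : ℕ} {α : G.PathN n} {x : G.BoundaryPath}
    (h : G.IsPrefix ⟨n, α⟩ x) : G.pathSource n α = G.bRange (G.shift^[n] x) := by
  induction n generalizing x with
  | zero => exact h.1
  | succ n ih =>
    rw [← G.pathSource_pathTail, ih (isPrefix_succ.1 h).2]
    rfl

theorem exists_concat {n : ℕ} (α : G.PathN n) (y : G.BoundaryPath)
    (h : G.pathSource n α = G.bRange y) :
    ∃ x : G.BoundaryPath, G.IsPrefix ⟨n, α⟩ x ∧ G.shift^[n] x = y := by
  induction n with
  | zero => exact ⟨y, isPrefix_zero.2 h, rfl⟩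
  | succ n ih =>
    obtain ⟨z, hz, rfl⟩ := ih (G.pathTail n α) (by rw [G.pathSource_pathTail, h])
    obtain ⟨x, hx, rfl⟩ := exists_cons_boundaryPath (firstEdge α) z (by rw [s_firstEdge, ← hz.1])
    exact ⟨x, isPrefix_succ.2 ⟨hx, hz⟩, rfl⟩

theorem IsPrefix.bRange_eq {n : ℕ} {α : G.PathN n} {x : G.BoundaryPath}
    (h : G.IsPrefix ⟨n, α⟩ x) : G.bRange x = G.pathRange n α := h.1.symm

theorem eq_of_isPrefix_of_shift_eq {n : ℕ} {α : G.PathN n} {x y : G.BoundaryPath}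
    (hx : G.IsPrefix ⟨n, α⟩ x) (hy : G.IsPrefix ⟨n, α⟩ y)
    (h : G.shift^[n] x = G.shift^[n] y) : x = y := by
  induction n generalizing x y with
  | zero => exact h
  | succ n ih =>
    have hx' := isPrefix_succ.1 hx
    have hy' := isPrefix_succ.1 hy
    exact shift_eq_imp_eq hx'.1 hy'.1 (ih hx'.2 hy'.2 h)

/-! ### Topology of the finite path spaces -/

theorem continuous_pathN_val (n : ℕ) :
    Continuous (fun α : G.PathN (n + 1) => (α.1 : Fin (n + 1) → E)) :=
  continuous_subtype_val

theorem isInducing_pathN_val (n : ℕ) :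
    IsInducing (fun α : G.PathN (n + 1) => (α.1 : Fin (n + 1) → E)) :=
  IsInducing.subtypeVal

theorem continuous_pathN_edge {n : ℕ} (i : Fin (n + 1)) :
    Continuous (fun α : G.PathN (n + 1) => α.1 i) :=
  (continuous_apply i).comp (continuous_pathN_val n)

theorem continuous_firstEdge {n : ℕ} : Continuous (firstEdge : G.PathN (n + 1) → E) :=
  continuous_pathN_edge _

theorem continuous_pathTail : ∀ n : ℕ, Continuous (G.pathTail n)
  | 0 => G.locHomeo_s.continuous.comp (continuous_pathN_edge _)
  | n + 1 => (isInducing_pathN_val n).continuous_iff.2 <|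
      continuous_pi fun i => continuous_pathN_edge (⟨i.1 + 1, by omega⟩ : Fin (n + 2))

theorem continuous_pathRange : ∀ n : ℕ, Continuous (G.pathRange n)
  | 0 => continuous_id
  | _ + 1 => G.cont_r.comp (continuous_pathN_edge _)

theorem continuous_pathSource : ∀ n : ℕ, Continuous (G.pathSource n)
  | 0 => continuous_id
  | _ + 1 => G.locHomeo_s.continuous.comp (continuous_pathN_edge _)

theorem isInducing_firstEdge_pathTail (n : ℕ) :
    IsInducing (fun α : G.PathN (n + 1) => (firstEdge α, G.pathTail n α)) := by
  have hc : Continuous (fun α : G.PathN (n + 1) => (firstEdge α, G.pathTail n α)) :=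
    continuous_firstEdge.prodMk (continuous_pathTail n)
  cases n with
  | zero =>
    refine IsInducing.of_comp hc (g := fun p => (fun _ => p.1 : Fin 1 → E))
      (continuous_pi fun _ => continuous_fst) ?_
    convert isInducing_pathN_val (G := G) 0 using 1
    funext α i
    obtain rfl : i = ⟨0, Nat.succ_pos _⟩ := Fin.ext (Nat.lt_one_iff.1 i.2)
    rfl
  | succ n =>
    refine IsInducing.of_comp hc
      (g := fun p => (Fin.cons p.1 p.2.1 : Fin (n + 2) → E)) ?_ ?_
    · refine continuous_pi fun i => Fin.cases ?_ (fun j => ?_) i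
      · exact continuous_fst
      · exact (continuous_pathN_edge j).comp continuous_snd
    · convert isInducing_pathN_val (G := G) (n + 1) using 1
      funext α i
      refine Fin.cases rfl (fun j => rfl) i

theorem isClosedEmbedding_firstEdge_pathTail [T2Space V] (n : ℕ) :
    IsClosedEmbedding (fun α : G.PathN (n + 1) => (firstEdge α, G.pathTail n α)) := by
  refine ⟨⟨isInducing_firstEdge_pathTail n, fun α β h => ?_⟩, ?_⟩
  · exact pathN_ext (congrArg Prod.fst h) (congrArg Prod.snd h)
  · have : range (fun α : G.PathN (n + 1) => (firstEdge α, G.pathTail n α)) =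
        {p : E × G.PathN n | G.s p.1 = G.pathRange n p.2} := by
      ext ⟨e, β⟩
      constructor
      · rintro ⟨α, hα⟩
        obtain ⟨rfl, rfl⟩ := Prod.mk.inj hα
        exact s_firstEdge α
      · intro h
        obtain ⟨α, rfl, rfl⟩ := exists_cons e β h
        exact ⟨α, rfl⟩
    rw [this]
    exact isClosed_eq (G.locHomeo_s.continuous.comp continuous_fst)
      ((continuous_pathRange n).comp continuous_snd)

theorem isCompact_cons [T2Space V] {n : ℕ} {C : Set E} {K : Set (G.PathN n)}
    (hC : IsCompact C) (hK : IsCompact K) :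
    IsCompact {α : G.PathN (n + 1) | firstEdge α ∈ C ∧ G.pathTail n α ∈ K} :=
  (isClosedEmbedding_firstEdge_pathTail n).isCompact_preimage (hC.prod hK)

theorem isOpen_cons {n : ℕ} {O : Set E} {T : Set (G.PathN n)}
    (hO : IsOpen O) (hT : IsOpen T) :
    IsOpen {α : G.PathN (n + 1) | firstEdge α ∈ O ∧ G.pathTail n α ∈ T} :=
  (hO.preimage continuous_firstEdge).inter (hT.preimage (continuous_pathTail n))

theorem exists_open_cons_subset {n : ℕ} {α : G.PathN (n + 1)} {U : Set (G.PathN (n + 1))}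
    (hU : U ∈ 𝓝 α) : ∃ (O : Set E) (T : Set (G.PathN n)), IsOpen O ∧ IsOpen T ∧
      firstEdge α ∈ O ∧ G.pathTail n α ∈ T ∧
      ∀ β : G.PathN (n + 1), firstEdge β ∈ O → G.pathTail n β ∈ T → β ∈ U := by
  rw [(isInducing_firstEdge_pathTail n).nhds_eq_comap, mem_comap] at hU
  obtain ⟨S, hS, hSU⟩ := hU
  obtain ⟨O, T, hO, heO, hT, hαT, hOT⟩ := mem_nhds_prod_iff'.1 hS
  exact ⟨O, T, hO, hT, heO, hαT, fun β h1 h2 => hSU (hOT ⟨h1, h2⟩)⟩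

theorem t2Space_pathN [T2Space V] [T2Space E] : ∀ n : ℕ, T2Space (G.PathN n)
  | 0 => inferInstanceAs (T2Space V)
  | n + 1 => inferInstanceAs
      (T2Space { μ : Fin (n + 1) → E // G.PathCond (n + 1) μ })

theorem map_nhds_pathTail {n : ℕ} (α : G.PathN (n + 1)) {A : Set (G.PathN (n + 1))}
    (hA : A ∈ 𝓝 α) : G.pathTail n '' A ∈ 𝓝 (G.pathTail n α) := by
  obtain ⟨O, T, hO, hT, heO, hαT, hOT⟩ := exists_open_cons_subset hA
  have h1 : IsOpen (T ∩ G.pathRange n ⁻¹' (G.s '' O)) :=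
    hT.inter ((G.locHomeo_s.isOpenMap O hO).preimage (continuous_pathRange n))
  refine mem_of_superset (h1.mem_nhds ⟨hαT, firstEdge α, heO, s_firstEdge α⟩) ?_
  rintro β ⟨hβ, e, he, hs⟩
  obtain ⟨γ, rfl, rfl⟩ := exists_cons e β hs
  exact ⟨γ, hOT γ he hβ, rfl⟩

theorem map_nhds_pathSource {n : ℕ} (α : G.PathN n) {A : Set (G.PathN n)}
    (hA : A ∈ 𝓝 α) : G.pathSource n '' A ∈ 𝓝 (G.pathSource n α) := by
  induction n with
  | zero => exact mem_of_superset hA fun v hv => ⟨v, hv, rfl⟩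
  | succ n ih =>
    have := ih _ (map_nhds_pathTail α hA)
    rw [G.pathSource_pathTail] at this
    refine mem_of_superset this ?_
    rintro _ ⟨_, ⟨β, hβ, rfl⟩, rfl⟩
    exact ⟨β, hβ, (G.pathSource_pathTail n β).symm⟩

theorem isOpen_image_pathSource {n : ℕ} {A : Set (G.PathN n)} (hA : IsOpen A) :
    IsOpen (G.pathSource n '' A) := by
  rw [isOpen_iff_mem_nhds]
  rintro _ ⟨α, hα, rfl⟩
  exact map_nhds_pathSource α (hA.mem_nhds hα)

theorem exists_open_injOn_s (G : TopGraph V E) (e : E) :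
    ∃ O : Set E, IsOpen O ∧ e ∈ O ∧ InjOn G.s O := by
  obtain ⟨φ, he, hφ⟩ := G.locHomeo_s e
  refine ⟨φ.source, φ.open_source, he, ?_⟩
  rw [hφ]
  exact φ.injOn

theorem exists_open_injOn_pathSource {n : ℕ} (α : G.PathN n) :
    ∃ O : Set (G.PathN n), IsOpen O ∧ α ∈ O ∧ InjOn (G.pathSource n) O := by
  induction n with
  | zero => exact ⟨univ, isOpen_univ, mem_univ _, fun a _ b _ h => h⟩
  | succ n ih =>
    obtain ⟨T, hT, hαT, hTi⟩ := ih (G.pathTail n α)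
    obtain ⟨O, hO, hαO, hOi⟩ := exists_open_injOn_s G (firstEdge α)
    refine ⟨_, isOpen_cons hO hT, ⟨hαO, hαT⟩, ?_⟩
    rintro β ⟨hβ1, hβ2⟩ γ ⟨hγ1, hγ2⟩ h
    rw [← G.pathSource_pathTail, ← G.pathSource_pathTail] at h
    have h' := hTi hβ2 hγ2 h
    exact pathN_ext (hOi hβ1 hγ1 (by rw [s_firstEdge, s_firstEdge, h'])) h'

theorem totallyDisc_pathN [T2Space V] (hV : TotallyDisc V) (hE : TotallyDisc E) :
    ∀ n : ℕ, TotallyDisc (G.PathN n)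
  | 0 => hV
  | n + 1 => by
    intro α U hU hα
    obtain ⟨O, T, hO, hT, heO, hαT, hOT⟩ := exists_open_cons_subset (hU.mem_nhds hα)
    obtain ⟨C, hC, hC', heC, hCO⟩ := hE _ O hO heO
    obtain ⟨K, hK, hK', hαK, hKT⟩ := totallyDisc_pathN hV hE n _ T hT hαT
    exact ⟨_, isCompact_cons hC hK, isOpen_cons hC' hK', ⟨heC, hαK⟩,
      fun β hβ => hOT β (hCO hβ.1) (hKT hβ.2)⟩

/-! ### Level cylinders -/

/-- The cylinder set in `∂E` of a set of paths of length `n`. -/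
def levelCyl (n : ℕ) (A : Set (G.PathN n)) : Set G.BoundaryPath :=
  {x | ∃ α ∈ A, G.IsPrefix ⟨n, α⟩ x}

theorem mem_levelCyl_zero {A : Set (G.PathN 0)} {x : G.BoundaryPath} :
    x ∈ levelCyl 0 A ↔ (G.bRange x : V) ∈ (A : Set V) := by
  constructor
  · rintro ⟨α, hα, h⟩
    have := isPrefix_zero.1 h
    rw [← this]; exact hα
  · intro h
    exact ⟨_, h, isPrefix_zero.2 rfl⟩

theorem mem_levelCyl_succ {n : ℕ} {O : Set E} {T : Set (G.PathN n)} {x : G.BoundaryPath} :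
    x ∈ levelCyl (n + 1) {α : G.PathN (n + 1) | firstEdge α ∈ O ∧ G.pathTail n α ∈ T} ↔
      (∃ e ∈ O, G.bEdge x 0 = some e) ∧ G.shift x ∈ levelCyl n T := by
  constructor
  · rintro ⟨α, ⟨h1, h2⟩, h⟩
    rw [isPrefix_succ] at h
    exact ⟨⟨_, h1, h.1⟩, _, h2, h.2⟩
  · rintro ⟨⟨e, he, hx⟩, β, hβ, h⟩
    obtain ⟨α, rfl, rfl⟩ := exists_cons e β (by rw [← bRange_shift hx]; exact h.1.symm)
    exact ⟨α, ⟨he, hβ⟩, isPrefix_succ.2 ⟨hx, h⟩⟩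

theorem levelCyl_mono {n : ℕ} {A B : Set (G.PathN n)} (h : A ⊆ B) :
    levelCyl n A ⊆ levelCyl n B := fun _ ⟨α, hα, hx⟩ => ⟨α, h hα, hx⟩

theorem levelCyl_inter {n : ℕ} {A B : Set (G.PathN n)} {x : G.BoundaryPath}
    (hA : x ∈ levelCyl n A) (hB : x ∈ levelCyl n B) : x ∈ levelCyl n (A ∩ B) := by
  obtain ⟨α, hα, hx⟩ := hA
  obtain ⟨β, hβ, hx'⟩ := hB
  obtain rfl := hx.eq hx'
  exact ⟨α, ⟨hα, hβ⟩, hx⟩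

theorem IsPrefix.mem_levelCyl_iff {n : ℕ} {A : Set (G.PathN n)} {α : G.PathN n}
    {x : G.BoundaryPath} (h : G.IsPrefix ⟨n, α⟩ x) : x ∈ levelCyl n A ↔ α ∈ A := by
  refine ⟨?_, fun hα => ⟨α, hα, h⟩⟩
  rintro ⟨β, hβ, hx⟩
  rwa [h.eq hx]

theorem le_bLen_of_mem_levelCyl {n : ℕ} {A : Set (G.PathN n)} {x : G.BoundaryPath}
    (h : x ∈ levelCyl n A) : (n : ℕ∞) ≤ G.bLen x := by
  obtain ⟨α, -, hx⟩ := h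
  exact hx.le_bLen

theorem cyl_image_mk {n : ℕ} (A : Set (G.PathN n)) :
    G.cyl ((fun α : G.PathN n => (⟨n, α⟩ : G.FinPath)) '' A) = levelCyl n A := by
  ext x
  constructor
  · rintro ⟨_, ⟨α, hα, rfl⟩, hx⟩
    exact ⟨α, hα, hx⟩
  · rintro ⟨α, hα, hx⟩
    exact ⟨_, ⟨α, hα, rfl⟩, hx⟩

theorem isOpen_levelCyl {n : ℕ} {A : Set (G.PathN n)} (hA : IsOpen A) :
    IsOpen (levelCyl n A) := by
  apply TopologicalSpace.isOpen_generateFrom_of_mem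
  refine ⟨(fun α : G.PathN n => (⟨n, α⟩ : G.FinPath)) '' A, ∅, ?_, isCompact_empty, ?_⟩
  · exact isOpenMap_sigmaMk (σ := G.PathN) A hA
  · rw [cyl_image_mk]
    simp [cyl]

theorem isClosed_levelCyl {n : ℕ} {K : Set (G.PathN n)} (hK : IsCompact K) :
    IsClosed (levelCyl n K) := by
  rw [← isOpen_compl_iff]
  apply TopologicalSpace.isOpen_generateFrom_of_mem
  refine ⟨univ, (fun α : G.PathN n => (⟨n, α⟩ : G.FinPath)) '' K, isOpen_univ, ?_, ?_⟩
  · exact hK.image (continuous_sigmaMk (σ := G.PathN))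
  · rw [cyl_image_mk, eq_comm]
    refine inter_eq_right.2 fun x _ => ?_
    exact ⟨⟨0, (G.bRange x : V)⟩, mem_univ _, isPrefix_zero.2 rfl⟩

theorem tendsto_nhds_boundaryPath {ι : Type*} {l : Filter ι} {f : ι → G.BoundaryPath}
    {x : G.BoundaryPath}
    (hU : ∀ (n : ℕ) (U : Set (G.PathN n)), IsOpen U → x ∈ levelCyl n U →
      ∀ᶠ a in l, f a ∈ levelCyl n U)
    (hK : ∀ (n : ℕ) (K : Set (G.PathN n)), IsCompact K → x ∉ levelCyl n K →
      ∀ᶠ a in l, f a ∉ levelCyl n K) : Tendsto f l (𝓝 x) := by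
  refine TopologicalSpace.tendsto_nhds_generateFrom_iff.2 ?_
  rintro _ ⟨U, K, hUo, hKc, rfl⟩ ⟨⟨⟨n, α⟩, hα, hx⟩, hxK⟩
  obtain ⟨t, c, ht, hc, hK'⟩ := IsCompact.sigma_exists_finite_sigma_eq (X := G.PathN) K hKc
  have h1 := hU n ((fun α : G.PathN n => (⟨n, α⟩ : G.FinPath)) ⁻¹' U)
    (hUo.preimage (continuous_sigmaMk (σ := G.PathN))) ⟨α, hα, hx⟩
  have h2 : ∀ᶠ a in l, ∀ m ∈ t, f a ∉ levelCyl m (c m) := by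
    refine (eventually_all_finite ht).2 fun m hm => hK m (c m) (hc m) ?_
    rintro ⟨β, hβ, hxβ⟩
    refine hxK ⟨⟨m, β⟩, ?_, hxβ⟩
    rw [← hK']
    exact ⟨hm, hβ⟩
  filter_upwards [h1, h2] with a ha1 ha2
  obtain ⟨β, hβ, haβ⟩ := ha1
  refine ⟨⟨⟨n, β⟩, hβ, haβ⟩, ?_⟩
  rintro ⟨⟨m, γ⟩, hγ, haγ⟩
  rw [← hK'] at hγ
  exact ha2 m hγ.1 ⟨γ, hγ.2, haγ⟩

theorem continuous_bRange : Continuous (G.bRange) := by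
  rw [continuous_def]
  intro U hU
  convert isOpen_levelCyl (G := G) (n := 0) (A := U) hU using 1
  ext x
  exact mem_levelCyl_zero.symm

theorem mem_levelCyl_firstEdge {O : Set E} {x : G.BoundaryPath} :
    x ∈ levelCyl 1 {α : G.PathN 1 | firstEdge α ∈ O} ↔ ∃ e ∈ O, G.bEdge x 0 = some e := by
  have h := mem_levelCyl_succ (n := 0) (O := O) (T := univ) (x := x)
  simp only [mem_univ, and_true] at h
  rw [h, and_iff_left]
  exact mem_levelCyl_zero.2 (mem_univ _)

theorem isOpen_bEdge_zero_mem {O : Set E} (hO : IsOpen O) :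
    IsOpen {x : G.BoundaryPath | ∃ e ∈ O, G.bEdge x 0 = some e} := by
  convert isOpen_levelCyl (G := G) (n := 1) (hO.preimage continuous_firstEdge) using 1
  ext x
  exact mem_levelCyl_firstEdge.symm

/-! ### The shift is a local homeomorphism -/

theorem continuousAt_shift [T2Space V] [LocallyCompactSpace E] {x : G.BoundaryPath} {e : E}
    (he : G.bEdge x 0 = some e) : ContinuousAt G.shift x := by
  refine tendsto_nhds_boundaryPath (fun n U hU hx => ?_) (fun n K hK hx => ?_)
  · have h := mem_levelCyl_succ.2 ⟨⟨e, mem_univ e, he⟩, hx⟩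
    filter_upwards [(isOpen_levelCyl (isOpen_cons isOpen_univ hU)).mem_nhds h] with y hy
    exact (mem_levelCyl_succ.1 hy).2
  · obtain ⟨C, hC, heC⟩ := exists_compact_mem_nhds e
    obtain ⟨O, hOC, hO, heO⟩ := mem_nhds_iff.1 heC
    have h1 := (isClosed_levelCyl (G := G) (isCompact_cons hC hK)).isOpen_compl.mem_nhds
      (x := x) fun h => hx (mem_levelCyl_succ.1 h).2
    filter_upwards [h1, (isOpen_bEdge_zero_mem hO).mem_nhds ⟨e, heO, he⟩] with y hy hyO hyK
    obtain ⟨e', he', hye⟩ := hyO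
    exact hy (mem_levelCyl_succ.2 ⟨⟨e', hOC he', hye⟩, hyK⟩)

theorem tendsto_of_tendsto_shift [T2Space V] [T2Space E] [LocallyCompactSpace E]
    {ι : Type*} {l : Filter ι} {f : ι → G.BoundaryPath} {x : G.BoundaryPath} {e : E}
    (he : G.bEdge x 0 = some e)
    (h0 : Tendsto (fun a => G.bEdge (f a) 0) l (map some (𝓝 e)))
    (h1 : Tendsto (fun a => G.shift (f a)) l (𝓝 (G.shift x))) : Tendsto f l (𝓝 x) := by
  have hO : ∀ O : Set E, O ∈ 𝓝 e → ∀ᶠ a in l, ∃ e' ∈ O, G.bEdge (f a) 0 = some e' := by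
    intro O hO
    filter_upwards [h0 (image_mem_map hO)] with a ⟨e', he', h⟩ using ⟨e', he', h.symm⟩
  refine tendsto_nhds_boundaryPath (fun n U hU hx => ?_) (fun n K hK hx => ?_)
  · cases n with
    | zero =>
      rw [mem_levelCyl_zero, bRange_of_bEdge_zero he] at hx
      filter_upwards [hO _ (G.cont_r.continuousAt.preimage_mem_nhds (hU.mem_nhds hx))]
        with a ⟨e', he', h⟩
      rw [mem_levelCyl_zero, bRange_of_bEdge_zero h]
      exact he'
    | succ n =>
      obtain ⟨α, hα, hx⟩ := hx
      obtain ⟨O, T, hOo, hT, hαO, hαT, hOT⟩ := exists_open_cons_subset (hU.mem_nhds hα)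
      rw [isPrefix_succ] at hx
      obtain rfl : firstEdge α = e := Option.some.inj (hx.1.symm.trans he)
      filter_upwards [hO _ (hOo.mem_nhds hαO),
        h1 ((isOpen_levelCyl hT).mem_nhds ⟨_, hαT, hx.2⟩)] with a ha1 ha2
      exact levelCyl_mono (fun β hβ => hOT β hβ.1 hβ.2) (mem_levelCyl_succ.2 ⟨ha1, ha2⟩)
  · have := t2Space_pathN (G := G)
    cases n with
    | zero =>
      rw [mem_levelCyl_zero, bRange_of_bEdge_zero he] at hx
      filter_upwards [hO _ (G.cont_r.continuousAt.preimage_mem_nhds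
        (hK.isClosed.isOpen_compl.mem_nhds hx))] with a ⟨e', he', h⟩
      rw [mem_levelCyl_zero, bRange_of_bEdge_zero h]
      exact he'
    | succ n =>
      obtain ⟨O, hOo, heO, hOi⟩ := exists_open_injOn_s G e
      obtain ⟨C, hC, hCO, hCc⟩ := local_compact_nhds (hOo.mem_nhds heO)
      have hKC : IsCompact (G.pathTail n '' (K ∩ firstEdge ⁻¹' C)) :=
        (hK.inter_right (hCc.isClosed.preimage continuous_firstEdge)).image
          (continuous_pathTail n)
      have hx' : G.shift x ∉ levelCyl n (G.pathTail n '' (K ∩ firstEdge ⁻¹' C)) := by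
        rintro ⟨_, ⟨κ, ⟨hκK, hκC⟩, rfl⟩, h⟩
        obtain rfl : firstEdge κ = e := by
          refine hOi (hCO hκC) heO ?_
          rw [s_firstEdge, ← bRange_shift he]
          exact h.1
        exact hx ⟨κ, hκK, isPrefix_succ.2 ⟨he, h⟩⟩
      filter_upwards [hO C hC, h1 ((isClosed_levelCyl hKC).isOpen_compl.mem_nhds hx')]
        with a ha1 ha2
      rintro ⟨κ, hκ, h⟩
      rw [isPrefix_succ] at h
      obtain ⟨e', he', h'⟩ := ha1
      obtain rfl : firstEdge κ = e' := Option.some.inj (h.1.symm.trans h')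
      exact ha2 ⟨_, ⟨κ, ⟨hκ, he'⟩, rfl⟩, h.2⟩

theorem image_shift_mem_nhds [T2Space V] [T2Space E] [LocallyCompactSpace E]
    {x : G.BoundaryPath} {e : E} (he : G.bEdge x 0 = some e) {A : Set G.BoundaryPath}
    (hA : A ∈ 𝓝 x) : G.shift '' A ∈ 𝓝 (G.shift x) := by
  have h : Tendsto id (comap (fun y => (G.bEdge y 0, G.shift y))
      (map some (𝓝 e) ×ˢ 𝓝 (G.shift x))) (𝓝 x) :=
    tendsto_of_tendsto_shift he (tendsto_fst.comp tendsto_comap) (tendsto_snd.comp tendsto_comap)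
  obtain ⟨S, hS, hSA⟩ := h hA
  obtain ⟨O, hO, T, hT, hOT⟩ := mem_prod_iff.1 hS
  have h1 : G.s '' (some ⁻¹' O) ∈ 𝓝 (G.bRange (G.shift x)) := by
    rw [bRange_shift he, ← G.locHomeo_s.map_nhds_eq]
    exact image_mem_map hO
  filter_upwards [hT, continuous_bRange.continuousAt.preimage_mem_nhds h1] with y hyT hyO
  obtain ⟨e', he', hs⟩ := hyO
  obtain ⟨z, hz, rfl⟩ := exists_cons_boundaryPath e' y hs
  refine ⟨z, hSA (hOT ⟨?_, hyT⟩), rfl⟩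
  change G.bEdge z 0 ∈ O
  rw [hz]; exact he'

theorem map_shift_iter_nhds [T2Space V] [T2Space E] [LocallyCompactSpace E]
    {k : ℕ} {x : G.BoundaryPath} (hk : (k : ℕ∞) ≤ G.bLen x) :
    map (G.shift^[k]) (𝓝 x) = 𝓝 (G.shift^[k] x) := by
  induction k with
  | zero => simp
  | succ k ih =>
    obtain ⟨e, he⟩ := Option.ne_none_iff_exists'.1 (succ_le_bLen_iff.1 hk)
    replace he : G.bEdge (G.shift^[k] x) 0 = some e := by rw [bEdge_shift_iter]; exact he
    rw [Function.iterate_succ', ← map_map, ih (le_bLen_mono k.le_succ hk)]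
    refine le_antisymm (continuousAt_shift he) fun A hA => ?_
    exact mem_of_superset (image_shift_mem_nhds he hA) (image_preimage_subset _ _)

theorem continuousAt_shift_iter [T2Space V] [T2Space E] [LocallyCompactSpace E]
    {k : ℕ} {x : G.BoundaryPath} (hk : (k : ℕ∞) ≤ G.bLen x) :
    ContinuousAt (G.shift^[k]) x := (map_shift_iter_nhds hk).le

theorem injOn_shift_iter_levelCyl {n : ℕ} {A : Set (G.PathN n)}
    (hA : InjOn (G.pathSource n) A) : InjOn (G.shift^[n]) (levelCyl n A) := by
  rintro x ⟨α, hα, hx⟩ y ⟨β, hβ, hy⟩ h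
  obtain rfl : α = β := hA hα hβ (by rw [hx.pathSource_eq, hy.pathSource_eq, h])
  exact eq_of_isPrefix_of_shift_eq hx hy h

theorem exists_open_injOn_shift_iter {k : ℕ} {x : G.BoundaryPath} (hk : (k : ℕ∞) ≤ G.bLen x) :
    ∃ O : Set G.BoundaryPath, IsOpen O ∧ x ∈ O ∧ (∀ y ∈ O, (k : ℕ∞) ≤ G.bLen y) ∧
      InjOn (G.shift^[k]) O := by
  obtain ⟨α, hα⟩ := exists_isPrefix hk
  obtain ⟨A, hA, hαA, hAi⟩ := exists_open_injOn_pathSource α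
  exact ⟨levelCyl k A, isOpen_levelCyl hA, ⟨α, hαA, hα⟩,
    fun y hy => le_bLen_of_mem_levelCyl hy, injOn_shift_iter_levelCyl hAi⟩

theorem isOpen_le_bLen (k : ℕ) : IsOpen {x : G.BoundaryPath | (k : ℕ∞) ≤ G.bLen x} := by
  convert isOpen_levelCyl (G := G) (n := k) isOpen_univ using 1
  ext x
  refine ⟨fun h => ?_, le_bLen_of_mem_levelCyl⟩
  obtain ⟨α, hα⟩ := exists_isPrefix h
  exact ⟨α, mem_univ _, hα⟩

theorem isOpen_inter_shift_iter_preimage [T2Space V] [T2Space E] [LocallyCompactSpace E]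
    {k : ℕ} {A W : Set G.BoundaryPath} (hA : IsOpen A) (hk : ∀ x ∈ A, (k : ℕ∞) ≤ G.bLen x)
    (hW : IsOpen W) : IsOpen (A ∩ G.shift^[k] ⁻¹' W) :=
  ContinuousOn.isOpen_inter_preimage
    (fun x hx => (continuousAt_shift_iter (hk x hx)).continuousWithinAt) hA hW

/-! ### Existence of boundary paths -/

theorem exists_r_eq_of_mem_rg [T2Space V] {v : V} (h : v ∈ G.rg) : ∃ e, G.r e = v := by
  obtain ⟨⟨N, hN, hvN, hc⟩, hsce⟩ := h
  have h1 : v ∈ closure (range G.r) := by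
    by_contra h'
    exact hsce (subset_closure h')
  have h2 : v ∈ closure (G.r '' (G.r ⁻¹' closure N)) := by
    rw [mem_closure_iff]
    intro O hO hvO
    obtain ⟨_, ⟨hw1, hw2⟩, e, rfl⟩ := mem_closure_iff.1 h1 (O ∩ N) (hO.inter hN) ⟨hvO, hvN⟩
    exact ⟨_, hw1, e, subset_closure hw2, rfl⟩
  rw [(hc.image G.cont_r).isClosed.closure_eq] at h2
  obtain ⟨e, -, he⟩ := h2
  exact ⟨e, he⟩

theorem exists_bRange_eq [T2Space V] (G : TopGraph V E) (v : V) :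
    ∃ x : G.BoundaryPath, G.bRange x = v := by
  classical
  by_contra hv
  have key : ∀ w : V, (¬ ∃ x : G.BoundaryPath, G.bRange x = w) →
      ∃ e, G.r e = w ∧ ¬ ∃ x : G.BoundaryPath, G.bRange x = G.s e := by
    intro w hw
    have hrg : w ∈ G.rg := by
      by_contra hsg
      exact hw ⟨Sum.inr ⟨⟨0, w⟩, hsg⟩, rfl⟩
    obtain ⟨e, he⟩ := exists_r_eq_of_mem_rg hrg
    refine ⟨e, he, ?_⟩
    rintro ⟨y, hy⟩
    obtain ⟨x, hx, -⟩ := exists_cons_boundaryPath e y hy.symm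
    exact hw ⟨x, (bRange_of_bEdge_zero hx).trans he⟩
  choose f hf hf' using key
  let S := {w : V // ¬ ∃ x : G.BoundaryPath, G.bRange x = w}
  let g : S → S := fun w => ⟨G.s (f w.1 w.2), hf' w.1 w.2⟩
  let u : ℕ → S := fun i => g^[i] ⟨v, hv⟩
  refine hv ⟨Sum.inl ⟨fun i => f (u i).1 (u i).2, fun i => ?_⟩, hf v hv⟩
  rw [hf]
  simp only [u, Function.iterate_succ_apply']
  rfl

/-! ### Small neighbourhoods in `∂E` -/

theorem exists_nhds_levelCyl_subset {n m : ℕ} (hnm : n ≤ m) {α : G.PathN m} {x : G.BoundaryPath}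
    (hα : G.IsPrefix ⟨m, α⟩ x) {U : Set (G.PathN n)} (hU : IsOpen U) (hx : x ∈ levelCyl n U) :
    ∃ A : Set (G.PathN m), IsOpen A ∧ α ∈ A ∧ levelCyl m A ⊆ levelCyl n U := by
  induction n generalizing m x with
  | zero =>
    refine ⟨G.pathRange m ⁻¹' U, IsOpen.preimage (continuous_pathRange m) hU, ?_, ?_⟩
    · have := mem_levelCyl_zero.1 hx
      rwa [hα.bRange_eq] at this
    · rintro y ⟨β, hβ, hy⟩
      rw [mem_levelCyl_zero, hy.bRange_eq]
      exact hβ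
  | succ n ih =>
    obtain ⟨m, rfl⟩ : ∃ m', m = m' + 1 := ⟨m - 1, by omega⟩
    obtain ⟨β, hβU, hβ⟩ := hx
    obtain ⟨O, T, hO, hT, hβO, hβT, hOT⟩ := exists_open_cons_subset (hU.mem_nhds hβU)
    rw [isPrefix_succ] at hα hβ
    obtain ⟨A, hA, hαA, hAT⟩ := ih (by omega) hα.2 hT ⟨_, hβT, hβ.2⟩
    refine ⟨_, isOpen_cons hO hA, ⟨?_, hαA⟩, ?_⟩
    · rwa [← Option.some.inj (hβ.1.symm.trans hα.1)]
    · intro y hy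
      have hy' := mem_levelCyl_succ.1 hy
      exact levelCyl_mono (fun γ hγ => hOT γ hγ.1 hγ.2)
        (mem_levelCyl_succ.2 ⟨hy'.1, hAT hy'.2⟩)

theorem exists_nhds_levelCyl_disjoint [T2Space V] [T2Space E] {n m : ℕ} (hnm : n ≤ m)
    {α : G.PathN m} {x : G.BoundaryPath} (hα : G.IsPrefix ⟨m, α⟩ x) {K : Set (G.PathN n)}
    (hK : IsCompact K) (hx : x ∉ levelCyl n K) :
    ∃ A : Set (G.PathN m), IsOpen A ∧ α ∈ A ∧ ∀ y ∈ levelCyl m A, y ∉ levelCyl n K := by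
  have := t2Space_pathN (G := G) n
  obtain ⟨β, hβ⟩ := exists_isPrefix (le_bLen_mono hnm hα.le_bLen)
  obtain ⟨A, hA, hαA, h⟩ := exists_nhds_levelCyl_subset hnm hα hK.isClosed.isOpen_compl
    ⟨β, fun h => hx ⟨β, h, hβ⟩, hβ⟩
  refine ⟨A, hA, hαA, fun y hy hyK => ?_⟩
  obtain ⟨γ, hγ, hyγ⟩ := levelCyl_inter (h hy) hyK
  exact hγ.1 hγ.2

/-- Neighbourhoods of an infinite path contain the cylinders of all its long prefixes. -/
theorem exists_levelCyl_subset_of_infinite [T2Space V] [T2Space E] {x : G.BoundaryPath}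
    (hx : ∀ m : ℕ, (m : ℕ∞) ≤ G.bLen x) {O : Set G.BoundaryPath} (hO : O ∈ 𝓝 x) :
    ∃ m₀ : ℕ, ∀ m ≥ m₀, ∃ A : Set (G.PathN m), IsOpen A ∧ x ∈ levelCyl m A ∧
      levelCyl m A ⊆ O := by
  let l : Filter G.BoundaryPath :=
    { sets := {O | ∃ m₀ : ℕ, ∀ m ≥ m₀, ∃ A : Set (G.PathN m), IsOpen A ∧ x ∈ levelCyl m A ∧
        levelCyl m A ⊆ O}
      univ_sets := by
        refine ⟨0, fun m _ => ⟨univ, isOpen_univ, ?_, subset_univ _⟩⟩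
        obtain ⟨α, hα⟩ := exists_isPrefix (hx m)
        exact ⟨α, mem_univ _, hα⟩
      sets_of_superset := by
        rintro S T ⟨m₀, h⟩ hST
        refine ⟨m₀, fun m hm => ?_⟩
        obtain ⟨A, hA, hxA, hAS⟩ := h m hm
        exact ⟨A, hA, hxA, hAS.trans hST⟩
      inter_sets := by
        rintro S T ⟨m₀, h⟩ ⟨m₁, h'⟩
        refine ⟨max m₀ m₁, fun m hm => ?_⟩
        obtain ⟨A, hA, hxA, hAS⟩ := h m (le_trans (le_max_left _ _) hm)
        obtain ⟨B, hB, hxB, hBT⟩ := h' m (le_trans (le_max_right _ _) hm)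
        exact ⟨A ∩ B, hA.inter hB, levelCyl_inter hxA hxB, subset_inter
          ((levelCyl_mono inter_subset_left).trans hAS)
          ((levelCyl_mono inter_subset_right).trans hBT)⟩ }
  have hl : Tendsto id l (𝓝 x) := by
    refine tendsto_nhds_boundaryPath (fun n U hU hxU => ?_) (fun n K hK hxK => ?_)
    · refine ⟨n, fun m hm => ?_⟩
      obtain ⟨α, hα⟩ := exists_isPrefix (hx m)
      obtain ⟨A, hA, hαA, h⟩ := exists_nhds_levelCyl_subset hm hα hU hxU
      exact ⟨A, hA, ⟨α, hαA, hα⟩, h⟩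
    · refine ⟨n, fun m hm => ?_⟩
      obtain ⟨α, hα⟩ := exists_isPrefix (hx m)
      obtain ⟨A, hA, hαA, h⟩ := exists_nhds_levelCyl_disjoint hm hα hK hxK
      exact ⟨A, hA, ⟨α, hαA, hα⟩, h⟩
  exact hl hO

theorem continuous_edge_lt {n i : ℕ} (hi : i < n) :
    ∃ f : G.PathN n → E, Continuous f ∧ ∀ α, G.pathEdge n α i = some (f α) := by
  cases n with
  | zero => omega
  | succ n => exact ⟨fun α => α.1 ⟨i, hi⟩, continuous_pathN_edge _, fun α => by simp [pathEdge, hi]⟩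

theorem exists_levelCyl_subset_of_finite [T2Space V] [T2Space E] {x : G.BoundaryPath} {p : ℕ}
    {α : G.PathN p} (hα : G.IsPrefix ⟨p, α⟩ x) (hp : G.bEdge x p = none)
    {O : Set G.BoundaryPath} (hO : O ∈ 𝓝 x) :
    ∃ (A : Set (G.PathN p)) (C : Set E), IsOpen A ∧ α ∈ A ∧ IsCompact C ∧
      ∀ y ∈ levelCyl p A, (∀ e ∈ C, G.bEdge y p ≠ some e) → y ∈ O := by
  let l : Filter G.BoundaryPath :=
    { sets := {O | ∃ (A : Set (G.PathN p)) (C : Set E), IsOpen A ∧ α ∈ A ∧ IsCompact C ∧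
        ∀ y ∈ levelCyl p A, (∀ e ∈ C, G.bEdge y p ≠ some e) → y ∈ O}
      univ_sets := ⟨univ, ∅, isOpen_univ, mem_univ _, isCompact_empty, fun _ _ _ => mem_univ _⟩
      sets_of_superset := by
        rintro S T ⟨A, C, hA, hαA, hC, h⟩ hST
        exact ⟨A, C, hA, hαA, hC, fun y hy hyC => hST (h y hy hyC)⟩
      inter_sets := by
        rintro S T ⟨A, C, hA, hαA, hC, h⟩ ⟨B, D, hB, hαB, hD, h'⟩
        refine ⟨A ∩ B, C ∪ D, hA.inter hB, ⟨hαA, hαB⟩, hC.union hD, fun y hy hyC => ⟨?_, ?_⟩⟩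
        · exact h y (levelCyl_mono inter_subset_left hy) fun e he => hyC e (Or.inl he)
        · exact h' y (levelCyl_mono inter_subset_right hy) fun e he => hyC e (Or.inr he) }
  have hl : Tendsto id l (𝓝 x) := by
    refine tendsto_nhds_boundaryPath (fun n U hU hxU => ?_) (fun n K hK hxK => ?_)
    · have hn : n ≤ p := by
        by_contra hn
        have := le_bLen_mono (by omega : p + 1 ≤ n) (le_bLen_of_mem_levelCyl hxU)
        exact succ_le_bLen_iff.1 this hp
      obtain ⟨A, hA, hαA, h⟩ := exists_nhds_levelCyl_subset hn hα hU hxU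
      exact ⟨A, ∅, hA, hαA, isCompact_empty, fun y hy _ => h hy⟩
    · by_cases hn : n ≤ p
      · obtain ⟨A, hA, hαA, h⟩ := exists_nhds_levelCyl_disjoint hn hα hK hxK
        exact ⟨A, ∅, hA, hαA, isCompact_empty, fun y hy _ => h y hy⟩
      · obtain ⟨f, hf, hf'⟩ := continuous_edge_lt (G := G) (not_le.1 hn)
        refine ⟨univ, f '' K, isOpen_univ, mem_univ _, hK.image hf, ?_⟩
        rintro y - hy ⟨κ, hκ, hyκ⟩
        exact hy _ ⟨κ, hκ, rfl⟩ ((hyκ.2 p (not_le.1 hn)).trans (hf' κ))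
  exact hl hO

/-- Every nonempty open subset of `∂E` contains a nonempty open cylinder set. -/
theorem exists_levelCyl_subset [T2Space V] [T2Space E] (hV : TotallyDisc V)
    {O : Set G.BoundaryPath} (hO : IsOpen O) (hne : O.Nonempty) :
    ∃ (n : ℕ) (A : Set (G.PathN n)), IsOpen A ∧ A.Nonempty ∧ levelCyl n A ⊆ O := by
  obtain ⟨x, hx⟩ := hne
  match x, hx with
  | Sum.inl μ, hx =>
    obtain ⟨m, h⟩ := exists_levelCyl_subset_of_infinite (x := Sum.inl μ) (fun m => le_top)
      (hO.mem_nhds hx)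
    obtain ⟨A, hA, ⟨α, hα, -⟩, h⟩ := h m le_rfl
    exact ⟨m, A, hA, ⟨α, hα⟩, h⟩
  | Sum.inr ⟨⟨p, α⟩, hα⟩, hx =>
    have hαx : G.IsPrefix ⟨p, α⟩ (Sum.inr ⟨⟨p, α⟩, hα⟩) := ⟨rfl, fun _ _ => rfl⟩
    obtain ⟨A, C, hA, hαA, hC, h⟩ := exists_levelCyl_subset_of_finite hαx (pathEdge_self α)
      (hO.mem_nhds hx)
    have hsA := map_nhds_pathSource α (hA.mem_nhds hαA)
    by_cases hsce : G.pathSource p α ∈ closure G.sce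
    · obtain ⟨_, ⟨β, hβ, rfl⟩, hβs⟩ := mem_closure_iff_nhds.1 hsce _ hsA
      refine ⟨p, A ∩ G.pathSource p ⁻¹' G.sce,
        hA.inter (isClosed_closure.isOpen_compl.preimage (continuous_pathSource p)),
        ⟨β, hβ, hβs⟩, ?_⟩
      rintro y ⟨γ, ⟨hγA, hγs⟩, hyγ⟩
      refine h y ⟨γ, hγA, hyγ⟩ fun e _ he => hγs (subset_closure ⟨e, ?_⟩)
      rw [hyγ.pathSource_eq, bRange_shift_iter he]
    · have hfin : G.pathSource p α ∉ G.finV := fun hf => hα ⟨hf, hsce⟩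
      obtain ⟨W, hWA, hW, hαW⟩ := mem_nhds_iff.1 hsA
      obtain ⟨N, hNc, hNo, hαN, hNW⟩ := hV _ W hW hαW
      obtain ⟨e, heN, heC⟩ : ∃ e ∈ G.r ⁻¹' N, e ∉ C := by
        by_contra! hcon
        refine hfin ⟨N, hNo, hαN, ?_⟩
        rw [hNc.isClosed.closure_eq]
        exact hC.of_isClosed_subset (hNc.isClosed.preimage G.cont_r) hcon
      obtain ⟨β, hβ, hβe⟩ := hWA (hNW heN)
      obtain ⟨z, hz⟩ := exists_bRange_eq G (G.s e)
      obtain ⟨y, hy, -⟩ := exists_cons_boundaryPath e z hz.symm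
      obtain ⟨w, hw, rfl⟩ := exists_concat β y (by rw [hβe, bRange_of_bEdge_zero hy])
      rw [bEdge_shift_iter] at hy
      have hlen : ((p + 1 : ℕ) : ℕ∞) ≤ G.bLen w := by
        rw [succ_le_bLen_iff]
        exact Option.ne_none_iff_exists'.2 ⟨e, hy⟩
      obtain ⟨γ, hγ⟩ := exists_isPrefix hlen
      obtain ⟨B, hB, hγB, hBA⟩ := exists_nhds_levelCyl_subset p.le_succ hγ hA ⟨β, hβ, hw⟩
      obtain ⟨f, hf, hf'⟩ := continuous_edge_lt (G := G) p.lt_succ_self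
      refine ⟨p + 1, B ∩ f ⁻¹' Cᶜ, hB.inter (hC.isClosed.isOpen_compl.preimage hf), ⟨γ, hγB, ?_⟩, ?_⟩
      · have : f γ = e := Option.some.inj (by rw [← hf', ← hγ.2 p p.lt_succ_self, ← hy]; rfl)
        change f γ ∉ C
        rwa [this]
      · rintro u ⟨δ, ⟨hδB, hδ⟩, hu⟩
        refine h u (hBA ⟨δ, hδB, hu⟩) fun e' he' hue => hδ ?_
        have : f δ = e' := Option.some.inj (by rw [← hf', ← hu.2 p p.lt_succ_self, hue])
        rwa [this]

/-! ### The boundary path space is locally compact and totally disconnected -/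

/-- The `i`-th edges of boundary paths converge to `e` along the filter `F`. -/
def EdgeLim (F : Filter G.BoundaryPath) (i : ℕ) (e : E) : Prop :=
  ∀ O ∈ 𝓝 e, ∀ᶠ x in F, ∃ e' ∈ O, G.bEdge x i = some e'

theorem exists_edgeLim_of_isCompact {F : Ultrafilter G.BoundaryPath} {i : ℕ} {C : Set E}
    (hC : IsCompact C) (h : ∀ᶠ x in F, ∃ e ∈ C, G.bEdge x i = some e) :
    ∃ e ∈ C, EdgeLim (F : Filter G.BoundaryPath) i e := by
  by_contra! hne
  have key : ∀ᶠ x in F, ¬ ∃ e ∈ C, G.bEdge x i = some e := by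
    refine hC.induction_on (p := fun S => ∀ᶠ x in F, ¬ ∃ e ∈ S, G.bEdge x i = some e)
      (by simp) (fun S T hST hT => ?_) (fun S T hS hT => ?_) (fun e he => ?_)
    · filter_upwards [hT] with x hx ⟨e, he, h⟩ using hx ⟨e, hST he, h⟩
    · filter_upwards [hS, hT] with x hx hx' ⟨e, he, h⟩
      exact he.elim (fun he => hx ⟨e, he, h⟩) fun he => hx' ⟨e, he, h⟩
    · have := hne e he
      simp only [EdgeLim, not_forall] at this
      obtain ⟨O, hO, hn⟩ := this
      exact ⟨O, mem_nhdsWithin_of_mem_nhds hO, Ultrafilter.eventually_not.2 hn⟩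
  obtain ⟨x, hx, hx'⟩ := (h.and key).exists
  exact hx' hx

theorem EdgeLim.tendsto_r {F : Filter G.BoundaryPath} {i : ℕ} {e : E} (h : EdgeLim F i e) :
    Tendsto (fun x => G.bRange (G.shift^[i] x)) F (𝓝 (G.r e)) := by
  intro N hN
  rw [mem_map]
  filter_upwards [h _ (G.cont_r.continuousAt.preimage_mem_nhds hN)] with x ⟨e', he', hx⟩
  rw [mem_preimage, bRange_shift_iter hx]
  exact he'

theorem EdgeLim.tendsto_s {F : Filter G.BoundaryPath} {i : ℕ} {e : E} (h : EdgeLim F i e) :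
    Tendsto (fun x => G.bRange (G.shift^[i + 1] x)) F (𝓝 (G.s e)) := by
  intro N hN
  rw [mem_map]
  filter_upwards [h _ (G.locHomeo_s.continuous.continuousAt.preimage_mem_nhds hN)]
    with x ⟨e', he', hx⟩
  rw [mem_preimage, bRange_shift_iter_succ hx]
  exact he'

theorem eventually_mem_levelCyl_of_edgeLim {n : ℕ} {F : Filter G.BoundaryPath} {β : G.PathN n}
    (hr : Tendsto G.bRange F (𝓝 (G.pathRange n β)))
    (he : ∀ i e, G.pathEdge n β i = some e → EdgeLim F i e) {U : Set (G.PathN n)}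
    (hU : U ∈ 𝓝 β) : ∀ᶠ x in F, x ∈ levelCyl n U := by
  induction n generalizing F with
  | zero =>
    filter_upwards [hr hU] with x hx
    exact mem_levelCyl_zero.2 hx
  | succ n ih =>
    obtain ⟨O, T, hO, hT, h1, h2, hOT⟩ := exists_open_cons_subset hU
    have h0 := he 0 _ (pathEdge_zero β)
    have h3 := ih (F := F.map G.shift) (β := G.pathTail n β) ?_ ?_ (hT.mem_nhds h2)
    · filter_upwards [h3, h0 O (hO.mem_nhds h1)] with x hx hx'
      exact levelCyl_mono (fun α hα => hOT α hα.1 hα.2) (mem_levelCyl_succ.2 ⟨hx', hx⟩)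
    · rw [← s_firstEdge]
      exact tendsto_map'_iff.2 h0.tendsto_s
    · intro i e hi O hO
      rw [← pathEdge_succ] at hi
      rw [eventually_map]
      filter_upwards [he _ _ hi O hO] with x hx
      simpa only [bEdge_shift] using hx

theorem ultrafilter_le_nhds_of_edgeLim [T2Space V] [T2Space E] {F : Ultrafilter G.BoundaryPath}
    {x : G.BoundaryPath} (hr : Tendsto G.bRange F (𝓝 (G.bRange x)))
    (he : ∀ i e, G.bEdge x i = some e → EdgeLim (F : Filter G.BoundaryPath) i e)
    (hn : ∀ i : ℕ, (i : ℕ∞) ≤ G.bLen x → G.bEdge x i = none → ∀ e, ¬ EdgeLim (F : Filter G.BoundaryPath) i e) :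
    (F : Filter G.BoundaryPath) ≤ 𝓝 x := by
  have key : ∀ (n : ℕ) (β : G.PathN n), G.IsPrefix ⟨n, β⟩ x → ∀ U ∈ 𝓝 β,
      ∀ᶠ y in F, y ∈ levelCyl n U := by
    intro n β hβ U hU
    refine eventually_mem_levelCyl_of_edgeLim (by rw [← hβ.1] at hr; exact hr)
      (fun i e hi => he i e ?_) hU
    rw [hβ.2 i ((pathEdge_ne_none β).1 (by rw [hi]; simp)), hi]
  refine tendsto_nhds_boundaryPath (f := id) (fun n U hU hx => ?_) (fun n K hK hx => ?_)
  · obtain ⟨β, hβU, hβ⟩ := hx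
    exact key n β hβ U (hU.mem_nhds hβU)
  · by_cases hnx : (n : ℕ∞) ≤ G.bLen x
    · have := t2Space_pathN (G := G) n
      obtain ⟨β, hβ⟩ := exists_isPrefix hnx
      filter_upwards [key n β hβ _ (hK.isClosed.isOpen_compl.mem_nhds
        fun h => hx ⟨β, h, hβ⟩)] with y hy hy'
      obtain ⟨α, h, -⟩ := levelCyl_inter hy hy'
      exact h.1 h.2
    · classical
      rw [le_bLen_iff] at hnx
      push Not at hnx
      obtain ⟨hi, hx⟩ := Nat.find_spec hnx
      have hix : ((Nat.find hnx : ℕ) : ℕ∞) ≤ G.bLen x := le_bLen_iff.2 fun j hj hjx =>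
        Nat.find_min hnx hj ⟨hj.trans hi, hjx⟩
      generalize Nat.find hnx = i at hi hx hix
      refine Ultrafilter.eventually_not.2 fun hF => ?_
      obtain ⟨f, hf, hf'⟩ := continuous_edge_lt (G := G) hi
      obtain ⟨e, -, h⟩ := exists_edgeLim_of_isCompact (F := F) (i := i) (hK.image hf) (by
        filter_upwards [hF] with y ⟨α, hα, hy⟩
        exact ⟨f α, mem_image_of_mem f hα, (hy.2 i hi).trans (hf' α)⟩)
      exact hn i hix hx e h

theorem exists_edgeLim_of_mem_rg {F : Ultrafilter G.BoundaryPath} {m : ℕ} {w : V}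
    (h : Tendsto (fun x => G.bRange (G.shift^[m] x)) F (𝓝 w)) (hw : w ∈ G.rg) :
    ∃ e, EdgeLim (F : Filter G.BoundaryPath) m e := by
  obtain ⟨⟨N, hN, hwN, hc⟩, hsce⟩ := hw
  have hO := (hN.inter isClosed_closure.isOpen_compl).mem_nhds ⟨hwN, hsce⟩
  obtain ⟨e, -, he⟩ := exists_edgeLim_of_isCompact (F := F) (i := m) hc (by
    filter_upwards [h hO] with x hx
    have hne : G.bEdge (G.shift^[m] x) 0 ≠ none := fun h0 =>
      (boundaryPath_eq_of_length_zero h0).1 ⟨⟨N, hN, hx.1, hc⟩, hx.2⟩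
    obtain ⟨e, he⟩ := Option.ne_none_iff_exists'.1 hne
    refine ⟨e, subset_closure ?_, by rwa [bEdge_shift_iter] at he⟩
    rw [← bRange_of_bEdge_zero he]
    exact hx.1)
  exact ⟨e, he⟩

theorem exists_pathN_of_edges (v : V) {m : ℕ} (e : ∀ i < m, E) (h0 : ∀ h, G.r (e 0 h) = v)
    (h : ∀ i (hi : i + 1 < m), G.s (e i (by omega)) = G.r (e (i + 1) hi)) :
    ∃ α : G.PathN m, G.pathRange m α = v ∧ ∀ i (hi : i < m), G.pathEdge m α i = some (e i hi) := by
  cases m with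
  | zero => exact ⟨v, rfl, fun i hi => absurd hi (Nat.not_lt_zero i)⟩
  | succ m =>
    exact ⟨⟨fun i => e i i.2, fun i hi => h i hi⟩, h0 m.succ_pos,
      fun i hi => by simp [pathEdge, hi]⟩

theorem isCompact_levelCyl_zero [T2Space V] [T2Space E] {K : Set V} (hK : IsCompact K) :
    IsCompact (levelCyl 0 K : Set G.BoundaryPath) := by
  classical
  rw [isCompact_iff_ultrafilter_le_nhds]
  intro F hF
  have hFK : ∀ᶠ x in F, G.bRange x ∈ K := by
    filter_upwards [le_principal_iff.1 hF] with x hx using mem_levelCyl_zero.1 hx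
  obtain ⟨v, hvK, hv⟩ := isCompact_iff_ultrafilter_le_nhds.1 hK (F.map G.bRange)
    (le_principal_iff.2 hFK)
  replace hv : Tendsto G.bRange F (𝓝 v) := hv
  have h0 : ∀ e, EdgeLim (F : Filter G.BoundaryPath) 0 e → G.r e = v := fun e he =>
    tendsto_nhds_unique he.tendsto_r hv
  have h1 : ∀ i e e', EdgeLim (F : Filter G.BoundaryPath) i e →
      EdgeLim (F : Filter G.BoundaryPath) (i + 1) e' → G.s e = G.r e' := fun i e e' h h' =>
    tendsto_nhds_unique h.tendsto_s h'.tendsto_r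
  suffices ∃ x : G.BoundaryPath, G.bRange x = v ∧
      (∀ i e, G.bEdge x i = some e → EdgeLim (F : Filter G.BoundaryPath) i e) ∧
      ∀ i : ℕ, (i : ℕ∞) ≤ G.bLen x → G.bEdge x i = none → ∀ e, ¬ EdgeLim (F : Filter G.BoundaryPath) i e by
    obtain ⟨x, rfl, hx, hx'⟩ := this
    exact ⟨x, mem_levelCyl_zero.2 hvK, ultrafilter_le_nhds_of_edgeLim hv hx hx'⟩
  by_cases hall : ∀ i, ∃ e, EdgeLim (F : Filter G.BoundaryPath) i e
  · choose e he using hall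
    exact ⟨Sum.inl ⟨e, fun i => h1 i _ _ (he i) (he (i + 1))⟩, h0 _ (he 0),
      fun i e' h => by rw [← Option.some.inj h]; exact he i, fun i _ h => by simp [bEdge] at h⟩
  · push Not at hall
    have hm := Nat.find_spec hall
    have hlt : ∀ i < Nat.find hall, ∃ e, EdgeLim (F : Filter G.BoundaryPath) i e := by
      intro i hi
      simpa using Nat.find_min hall hi
    set m := Nat.find hall
    choose e he using hlt
    obtain ⟨α, hαv, hα⟩ := exists_pathN_of_edges (G := G) v e (fun h => h0 _ (he 0 h))
      fun i hi => h1 i _ _ (he i _) (he (i + 1) hi)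
    have hlim : ∀ i e', G.pathEdge m α i = some e' →
        EdgeLim (F : Filter G.BoundaryPath) i e' := by
      intro i e' hi
      have him : i < m := (pathEdge_ne_none α).1 (by rw [hi]; simp)
      rw [hα i him] at hi
      rw [← Option.some.inj hi]
      exact he i him
    have hs : Tendsto (fun x => G.bRange (G.shift^[m] x)) F (𝓝 (G.pathSource m α)) := by
      clear_value m
      cases m with
      | zero => rw [← hαv] at hv; exact hv
      | succ m => exact (hlim m _ (by simp [pathEdge])).tendsto_s
    have hsg : G.pathSource m α ∈ G.sg := fun hrg => by
      obtain ⟨e', he'⟩ := exists_edgeLim_of_mem_rg hs hrg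
      exact hm e' he'
    refine ⟨Sum.inr ⟨⟨m, α⟩, hsg⟩, hαv, hlim, fun i him hi => ?_⟩
    have hmi : ¬ i < m := fun h => (pathEdge_ne_none α).2 h hi
    have him' : i ≤ m := Nat.cast_le.1 him
    obtain rfl : i = m := by omega
    exact hm

theorem isCompact_levelCyl [T2Space V] [T2Space E] {n : ℕ} {K : Set (G.PathN n)}
    (hK : IsCompact K) : IsCompact (levelCyl n K) := by
  refine (isCompact_levelCyl_zero (hK.image (continuous_pathRange n))).of_isClosed_subset
    (isClosed_levelCyl hK) ?_
  rintro x ⟨α, hα, hx⟩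
  exact mem_levelCyl_zero.2 ⟨α, hα, hx.1⟩

theorem exists_levelCyl_separating [T2Space V] [T2Space E] {x y : G.BoundaryPath} (h : x ≠ y) :
    ∃ (n : ℕ) (α : G.PathN n),
      (G.IsPrefix ⟨n, α⟩ x ∧ ¬ G.IsPrefix ⟨n, α⟩ y) ∨
        (G.IsPrefix ⟨n, α⟩ y ∧ ¬ G.IsPrefix ⟨n, α⟩ x) := by
  by_contra! hne
  have key : ∀ {n : ℕ} {α : G.PathN n}, G.IsPrefix ⟨n, α⟩ x ↔ G.IsPrefix ⟨n, α⟩ y :=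
    fun {n α} => ⟨(hne n α).1, (hne n α).2⟩
  obtain ⟨v, hv⟩ := exists_isPrefix (n := 0) (x := x) (by simp)
  refine h (boundaryPath_ext (hv.1.symm.trans (key.1 hv).1) fun i => ?_)
  by_cases hx : ((i + 1 : ℕ) : ℕ∞) ≤ G.bLen x
  · obtain ⟨α, hα⟩ := exists_isPrefix hx
    rw [hα.2 i i.lt_succ_self, (key.1 hα).2 i i.lt_succ_self]
  by_cases hy : ((i + 1 : ℕ) : ℕ∞) ≤ G.bLen y
  · obtain ⟨α, hα⟩ := exists_isPrefix hy
    exact absurd (key.2 hα).le_bLen hx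
  rw [succ_le_bLen_iff, not_not] at hx hy
  rw [hx, hy]

theorem exists_isClopen_levelCyl_separating [T2Space V] [T2Space E] (hV : TotallyDisc V)
    (hE : TotallyDisc E) {n : ℕ} {α : G.PathN n} {x y : G.BoundaryPath}
    (hx : G.IsPrefix ⟨n, α⟩ x) (hy : ¬ G.IsPrefix ⟨n, α⟩ y) :
    ∃ W : Set G.BoundaryPath, IsClopen W ∧ x ∈ W ∧ y ∉ W := by
  have := t2Space_pathN (G := G) n
  have : ∃ U : Set (G.PathN n), IsOpen U ∧ α ∈ U ∧ y ∉ levelCyl n U := by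
    by_cases hny : (n : ℕ∞) ≤ G.bLen y
    · obtain ⟨β, hβ⟩ := exists_isPrefix hny
      refine ⟨{β}ᶜ, isOpen_compl_singleton, fun h => hy (mem_singleton_iff.1 h ▸ hβ), fun h => ?_⟩
      exact hβ.mem_levelCyl_iff.1 h rfl
    · exact ⟨univ, isOpen_univ, mem_univ _, fun h => hny (le_bLen_of_mem_levelCyl h)⟩
  obtain ⟨U, hU, hαU, hyU⟩ := this
  obtain ⟨W, hWc, hWo, hαW, hWU⟩ := totallyDisc_pathN hV hE n α U hU hαU
  exact ⟨levelCyl n W, ⟨isClosed_levelCyl hWc, isOpen_levelCyl hWo⟩, ⟨α, hαW, hx⟩,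
    fun h => hyU (levelCyl_mono hWU h)⟩

theorem totallySeparatedSpace_boundaryPath [T2Space V] [T2Space E] (hV : TotallyDisc V)
    (hE : TotallyDisc E) : TotallySeparatedSpace G.BoundaryPath := by
  rw [totallySeparatedSpace_iff_exists_isClopen]
  intro x y h
  obtain ⟨n, α, ⟨hx, hy⟩ | ⟨hy, hx⟩⟩ := exists_levelCyl_separating h
  · exact exists_isClopen_levelCyl_separating hV hE hx hy
  · obtain ⟨W, hW, h1, h2⟩ := exists_isClopen_levelCyl_separating hV hE hy hx
    exact ⟨Wᶜ, hW.compl, h2, fun h => h h1⟩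

theorem locallyCompactSpace_boundaryPath [T2Space V] [T2Space E] [LocallyCompactSpace V]
    (hV : TotallyDisc V) (hE : TotallyDisc E) : LocallyCompactSpace G.BoundaryPath := by
  have := totallySeparatedSpace_boundaryPath (G := G) hV hE
  have : WeaklyLocallyCompactSpace G.BoundaryPath := ⟨fun x => by
    obtain ⟨K, hK, hKx⟩ := exists_compact_mem_nhds (G.bRange x)
    refine ⟨levelCyl 0 K, isCompact_levelCyl_zero hK, ?_⟩
    filter_upwards [continuous_bRange.continuousAt hKx] with y hy
    exact mem_levelCyl_zero.2 hy⟩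
  infer_instance

theorem exists_isClopen_subset [T2Space V] [T2Space E] [LocallyCompactSpace V]
    (hV : TotallyDisc V) (hE : TotallyDisc E) {x : G.BoundaryPath} {O : Set G.BoundaryPath}
    (hO : O ∈ 𝓝 x) : ∃ D : Set G.BoundaryPath, IsClopen D ∧ x ∈ D ∧ D ⊆ O := by
  have := totallySeparatedSpace_boundaryPath (G := G) hV hE
  have := locallyCompactSpace_boundaryPath (G := G) hV hE
  obtain ⟨D, hD, hxD, hDO⟩ :=
    (loc_compact_Haus_tot_disc_of_zero_dim (H := G.BoundaryPath)).mem_nhds_iff.1 hO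
  exact ⟨D, hD, hxD, hDO⟩

/-! ### Cofinality and orbits -/

theorem exists_shift_iter_eq_of_cofinal [T2Space V] [T2Space E] (hV : TotallyDisc V)
    (hcf : G.Cofinal) (x : G.BoundaryPath) {W : Set G.BoundaryPath} (hW : IsOpen W)
    (hne : W.Nonempty) : ∃ y ∈ W, ∃ k l : ℕ, (k : ℕ∞) ≤ G.bLen y ∧ (l : ℕ∞) ≤ G.bLen x ∧
      G.shift^[k] y = G.shift^[l] x := by
  obtain ⟨n, A, hA, hAne, hAW⟩ := exists_levelCyl_subset hV hW hne
  obtain ⟨_, hv, ⟨α, hα, rfl⟩⟩ :=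
    (hcf x).exists_mem_open (isOpen_image_pathSource hA) (hAne.image _)
  have : ∃ (l p : ℕ) (ν : G.PathN p), (l : ℕ∞) ≤ G.bLen x ∧
      G.pathRange p ν = G.pathSource n α ∧ G.pathSource p ν = G.bRange (G.shift^[l] x) := by
    rcases hv with ⟨p, ν, h1, h2⟩ | ⟨i, e, he, p, ν, h1, h2⟩
    · exact ⟨0, p, ν, by simp, h1, h2⟩
    · exact ⟨i + 1, p, ν, succ_le_bLen_iff.2 (by rw [he]; simp), h1,
        by rw [bRange_shift_iter_succ he, h2]⟩
  obtain ⟨l, p, ν, hl, h1, h2⟩ := this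
  obtain ⟨z, hz, hz'⟩ := exists_concat ν _ h2
  obtain ⟨y, hy, hy'⟩ := exists_concat α z (by rw [← h1, hz.1])
  refine ⟨y, hAW ⟨α, hα, hy⟩, p + n, l, ?_, hl, ?_⟩
  · rw [add_comm, add_le_bLen_iff, hy']
    exact ⟨hy.le_bLen, hz.le_bLen⟩
  · rw [Function.iterate_add_apply, hy', hz']

/-! ### Basic open sets and bisections of the boundary path groupoid -/

/-- The set `𝒰(A, D, k, l)` of groupoid elements. -/
def basicSet (A D : Set G.BoundaryPath) (k l : ℕ) : Set G.BPGroupoid :=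
  {x | G.gR x ∈ A ∧ G.gS x ∈ D ∧ x.1.2.1 = (k : ℤ) - (l : ℤ) ∧
    G.shift^[k] (G.gR x) = G.shift^[l] (G.gS x)}

theorem isOpen_basicSet {A D : Set G.BoundaryPath} {k l : ℕ} (hA : IsOpen A) (hD : IsOpen D)
    (hAk : ∀ x ∈ A, (k : ℕ∞) ≤ G.bLen x) (hDl : ∀ x ∈ D, (l : ℕ∞) ≤ G.bLen x)
    (hAi : InjOn (G.shift^[k]) A) (hDi : InjOn (G.shift^[l]) D) : IsOpen (basicSet A D k l) :=
  TopologicalSpace.isOpen_generateFrom_of_mem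
    ⟨A, D, k, l, hA, hD, hAk, hDl, hAi, hDi, rfl⟩

theorem exists_basicSet_subset (g : G.BPGroupoid) {O O' : Set G.BoundaryPath} (hO : IsOpen O)
    (hgO : G.gR g ∈ O) (hO' : IsOpen O') (hgO' : G.gS g ∈ O') :
    ∃ N : Set G.BPGroupoid, IsOpen N ∧ g ∈ N ∧ ∀ h ∈ N, G.gR h ∈ O ∧ G.gS h ∈ O' := by
  obtain ⟨k, l, hkl, hk, hl, h⟩ := g.2
  obtain ⟨A, hA, hgA, hAk, hAi⟩ := exists_open_injOn_shift_iter hk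
  obtain ⟨D, hD, hgD, hDl, hDi⟩ := exists_open_injOn_shift_iter hl
  exact ⟨basicSet (A ∩ O) (D ∩ O') k l, isOpen_basicSet (hA.inter hO) (hD.inter hO')
    (fun x hx => hAk x hx.1) (fun x hx => hDl x hx.1) (hAi.mono inter_subset_left)
    (hDi.mono inter_subset_left), ⟨⟨hgA, hgO⟩, ⟨hgD, hgO'⟩, hkl, h⟩,
    fun h hh => ⟨hh.1.2, hh.2.1.2⟩⟩

theorem continuous_gR : Continuous (G.gR) := by
  refine continuous_def.2 fun O hO => isOpen_iff_mem_nhds.2 fun g hg => ?_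
  obtain ⟨N, hN, hgN, h⟩ := exists_basicSet_subset g hO hg isOpen_univ (mem_univ _)
  exact mem_of_superset (hN.mem_nhds hgN) fun x hx => (h x hx).1

theorem continuous_gS : Continuous (G.gS) := by
  refine continuous_def.2 fun O hO => isOpen_iff_mem_nhds.2 fun g hg => ?_
  obtain ⟨N, hN, hgN, h⟩ := exists_basicSet_subset g isOpen_univ (mem_univ _) hO hg
  exact mem_of_superset (hN.mem_nhds hgN) fun x hx => (h x hx).2

theorem tendsto_bpGroupoid [T2Space V] [T2Space E] [LocallyCompactSpace E] {ι : Type*}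
    {F : Filter ι} {f : ι → G.BPGroupoid} {g : G.BPGroupoid} {A D : Set G.BoundaryPath}
    {k l : ℕ} (hAk : ∀ x ∈ A, (k : ℕ∞) ≤ G.bLen x) (hDl : ∀ x ∈ D, (l : ℕ∞) ≤ G.bLen x)
    (hg : g ∈ basicSet A D k l) (hf : ∀ᶠ a in F, f a ∈ basicSet A D k l)
    (hR : Tendsto (fun a => G.gR (f a)) F (𝓝 (G.gR g)))
    (hS : Tendsto (fun a => G.gS (f a)) F (𝓝 (G.gS g))) : Tendsto f F (𝓝 g) := by
  rw [TopologicalSpace.tendsto_nhds_generateFrom_iff]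
  rintro _ ⟨U, W, k', l', hU, hW, hUk, hWl, hUi, hWi, rfl⟩ ⟨h1, h2, h3, h4⟩
  have hkl : (k : ℤ) - l = k' - l' := hg.2.2.1.symm.trans h3
  have key : ∀ᶠ a in F, G.shift^[k'] (G.gR (f a)) = G.shift^[l'] (G.gS (f a)) := by
    rcases le_total k k' with hkk | hkk
    · obtain ⟨d, rfl⟩ := Nat.exists_eq_add_of_le hkk
      obtain rfl : l' = l + d := by omega
      filter_upwards [hf] with a ha
      rw [add_comm k, add_comm l, Function.iterate_add_apply, Function.iterate_add_apply,
        ha.2.2.2]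
    · obtain ⟨d, rfl⟩ := Nat.exists_eq_add_of_le hkk
      obtain rfl : l = l' + d := by omega
      have hk := add_le_bLen_iff.1 (hAk _ hg.1)
      have hl := add_le_bLen_iff.1 (hDl _ hg.2.1)
      obtain ⟨P, hP, hgP, -, hPi⟩ := exists_open_injOn_shift_iter hk.2
      have hR' := ((continuousAt_shift_iter hk.1).tendsto.comp hR) (hP.mem_nhds hgP)
      have hS' := ((continuousAt_shift_iter hl.1).tendsto.comp hS)
        (hP.mem_nhds (by rw [← h4]; exact hgP))
      filter_upwards [hf, hR', hS'] with a ha haR haS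
      refine hPi haR haS ?_
      have := ha.2.2.2
      rwa [add_comm k', add_comm l', Function.iterate_add_apply, Function.iterate_add_apply]
        at this
  filter_upwards [hf, key, hR (hU.mem_nhds h1), hS (hW.mem_nhds h2)] with a ha hk haR haS
  exact ⟨haR, haS, ha.2.2.1.trans hkl, hk⟩

theorem tendsto_of_shift_iter_eq [T2Space V] [T2Space E] [LocallyCompactSpace E] {ι : Type*}
    {F : Filter ι} {f f' : ι → G.BoundaryPath} {x y : G.BoundaryPath} {A : Set G.BoundaryPath}
    {k l : ℕ} (hA : IsOpen A) (hAk : ∀ x ∈ A, (k : ℕ∞) ≤ G.bLen x)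
    (hAi : InjOn (G.shift^[k]) A) (hyA : y ∈ A) (hl : (l : ℕ∞) ≤ G.bLen x)
    (hxy : G.shift^[k] y = G.shift^[l] x)
    (hf : ∀ᶠ a in F, f a ∈ A ∧ G.shift^[k] (f a) = G.shift^[l] (f' a))
    (hf' : Tendsto f' F (𝓝 x)) : Tendsto f F (𝓝 y) := by
  intro O hO
  have h1 : G.shift^[k] '' (O ∩ A) ∈ 𝓝 (G.shift^[l] x) := by
    rw [← hxy, ← map_shift_iter_nhds (hAk y hyA)]
    exact image_mem_map (inter_mem hO (hA.mem_nhds hyA))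
  rw [mem_map]
  filter_upwards [hf, ((continuousAt_shift_iter hl).tendsto.comp hf') h1] with a ha ⟨b, hb, hba⟩
  have : b = f a := hAi hb.2 ha.1 (hba.trans ha.2.symm)
  rw [mem_preimage, ← this]
  exact hb.1

theorem isBisection_iUnion_basicSet [T2Space V] [T2Space E] [LocallyCompactSpace E] {ι : Type*}
    {A D : ι → Set G.BoundaryPath} {k l : ι → ℕ} (hA : ∀ i, IsOpen (A i))
    (hD : ∀ i, IsOpen (D i)) (hAk : ∀ i, ∀ x ∈ A i, (k i : ℕ∞) ≤ G.bLen x)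
    (hDl : ∀ i, ∀ x ∈ D i, (l i : ℕ∞) ≤ G.bLen x) (hAi : ∀ i, InjOn (G.shift^[k i]) (A i))
    (hDi : ∀ i, InjOn (G.shift^[l i]) (D i)) (hAd : ∀ i j x, x ∈ A i → x ∈ A j → i = j)
    (hDd : ∀ i j x, x ∈ D i → x ∈ D j → i = j) :
    G.IsBisection (⋃ i, basicSet (A i) (D i) (k i) (l i)) := by
  set N := ⋃ i, basicSet (A i) (D i) (k i) (l i)
  have memN : ∀ g : N, ∃ i, g.1 ∈ basicSet (A i) (D i) (k i) (l i) := fun g => mem_iUnion.1 g.2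
  refine ⟨⟨isInducing_iff_nhds.2 fun g => le_antisymm ?_ ?_, fun g h hgh => ?_⟩,
    ⟨isInducing_iff_nhds.2 fun g => le_antisymm ?_ ?_, fun g h hgh => ?_⟩⟩
  · exact ((continuous_gS.comp continuous_subtype_val).tendsto g).le_comap
  · obtain ⟨i, hi⟩ := memN g
    rw [nhds_subtype, ← tendsto_iff_comap]
    have hS : Tendsto (fun h : N => G.gS h.1) (comap (N.domRestrict G.gS) (𝓝 (G.gS g.1)))
      (𝓝 (G.gS g.1)) := tendsto_comap
    have hf : ∀ᶠ h in comap (N.domRestrict G.gS) (𝓝 (G.gS g.1)),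
        h.1 ∈ basicSet (A i) (D i) (k i) (l i) := by
      filter_upwards [hS ((hD i).mem_nhds hi.2.1)] with h hh
      obtain ⟨j, hj⟩ := memN h
      obtain rfl := hDd i j _ hh hj.2.1
      exact hj
    exact tendsto_bpGroupoid (hAk i) (hDl i) hi hf
      (tendsto_of_shift_iter_eq (hA i) (hAk i) (hAi i) hi.1 (hDl i _ hi.2.1) hi.2.2.2
        (hf.mono fun h hh => ⟨hh.1, hh.2.2.2⟩) hS) hS
  · obtain ⟨i, hi⟩ := memN g
    obtain ⟨j, hj⟩ := memN h
    replace hgh : G.gS g.1 = G.gS h.1 := hgh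
    obtain rfl := hDd i j _ hi.2.1 (by rw [hgh]; exact hj.2.1)
    have hR : G.gR g.1 = G.gR h.1 := hAi i hi.1 hj.1 (by rw [hi.2.2.2, hj.2.2.2, hgh])
    exact Subtype.ext (Subtype.ext (Prod.ext hR (Prod.ext (hi.2.2.1.trans hj.2.2.1.symm) hgh)))
  · exact ((continuous_gR.comp continuous_subtype_val).tendsto g).le_comap
  · obtain ⟨i, hi⟩ := memN g
    rw [nhds_subtype, ← tendsto_iff_comap]
    have hR : Tendsto (fun h : N => G.gR h.1) (comap (N.domRestrict G.gR) (𝓝 (G.gR g.1)))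
      (𝓝 (G.gR g.1)) := tendsto_comap
    have hf : ∀ᶠ h in comap (N.domRestrict G.gR) (𝓝 (G.gR g.1)),
        h.1 ∈ basicSet (A i) (D i) (k i) (l i) := by
      filter_upwards [hR ((hA i).mem_nhds hi.1)] with h hh
      obtain ⟨j, hj⟩ := memN h
      obtain rfl := hAd i j _ hh hj.1
      exact hj
    exact tendsto_bpGroupoid (hAk i) (hDl i) hi hf hR
      (tendsto_of_shift_iter_eq (hD i) (hDl i) (hDi i) hi.2.1 (hAk i _ hi.1) hi.2.2.2.symm
        (hf.mono fun h hh => ⟨hh.2.1, hh.2.2.2.symm⟩) hR)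
  · obtain ⟨i, hi⟩ := memN g
    obtain ⟨j, hj⟩ := memN h
    replace hgh : G.gR g.1 = G.gR h.1 := hgh
    obtain rfl := hAd i j _ hi.1 (by rw [hgh]; exact hj.1)
    have hS : G.gS g.1 = G.gS h.1 :=
      hDi i hi.2.1 hj.2.1 (by rw [← hi.2.2.2, ← hj.2.2.2, hgh])
    exact Subtype.ext (Subtype.ext (Prod.ext hgh (Prod.ext (hi.2.2.1.trans hj.2.2.1.symm) hS)))

/-! ### The infinite path of a cycle -/

theorem exists_infinite_path_of_isCycle {n : ℕ} {γ : G.PathN (n + 1)} (h : G.IsCycle n γ) :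
    ∃ x : G.BoundaryPath, (∀ m : ℕ, (m : ℕ∞) ≤ G.bLen x) ∧ G.bRange x = G.pathRange (n + 1) γ ∧
      (∀ i : Fin (n + 1), G.bEdge x i = some (γ.1 i)) ∧ G.shift^[n + 1] x = x := by
  have hγ : ∀ m (hm : m < n + 1), G.s (γ.1 ⟨m, hm⟩) =
      G.r (γ.1 ⟨(m + 1) % (n + 1), Nat.mod_lt _ n.succ_pos⟩) := by
    intro m hm
    by_cases hm' : m + 1 < n + 1
    · simp only [Nat.mod_eq_of_lt hm']
      exact γ.2 m hm'
    · obtain rfl : m = n := by omega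
      simp only [Nat.mod_self]
      exact h.symm
  obtain ⟨x, hx⟩ : ∃ x : G.BoundaryPath,
      ∀ i, G.bEdge x i = some (γ.1 ⟨i % (n + 1), Nat.mod_lt _ n.succ_pos⟩) := by
    refine ⟨Sum.inl ⟨fun i => γ.1 ⟨i % (n + 1), Nat.mod_lt _ n.succ_pos⟩, fun i => ?_⟩,
      fun i => rfl⟩
    rw [hγ]
    simp only [Nat.mod_add_mod]
  have hr : G.bRange x = G.pathRange (n + 1) γ := by
    rw [bRange_of_bEdge_zero (hx 0)]
    simp [pathRange]
  have hs : ∀ i, G.bEdge (G.shift^[n + 1] x) i = G.bEdge x i := fun i => by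
    rw [bEdge_shift_iter, hx, hx]
    simp only [Nat.add_mod_left]
  refine ⟨x, fun m => le_bLen_iff.2 fun i _ => by rw [hx]; simp, hr, fun i => ?_,
    boundaryPath_ext ?_ hs⟩
  · rw [hx]
    simp only [Nat.mod_eq_of_lt i.2]
  · rw [bRange_of_bEdge_zero (hx 0), bRange_of_bEdge_zero ((hs 0).trans (hx 0))]

theorem shift_iter_mul_of_shift_iter_eq {p : ℕ} {x : G.BoundaryPath} (h : G.shift^[p] x = x)
    (m : ℕ) : G.shift^[p * m] x = x := by
  rw [Function.iterate_mul]
  exact Function.iterate_fixed h m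

theorem mem_levelCyl_of_agree {n : ℕ} {A : Set (G.PathN n)} {x y : G.BoundaryPath}
    (hx : x ∈ levelCyl n A) (hr : G.bRange y = G.bRange x)
    (he : ∀ i < n, G.bEdge y i = G.bEdge x i) : y ∈ levelCyl n A := by
  obtain ⟨α, hα, h⟩ := hx
  exact ⟨α, hα, h.1.trans hr.symm, fun i hi => (he i hi).trans (h.2 i hi)⟩

theorem exists_deviating_path [T2Space V] {x : G.BoundaryPath} {q : ℕ} {e : E}
    (hq : (q : ℕ∞) ≤ G.bLen x) (he : G.bRange (G.shift^[q] x) = G.r e) :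
    ∃ y : G.BoundaryPath, G.bRange y = G.bRange x ∧ (∀ i < q, G.bEdge y i = G.bEdge x i) ∧
      G.bEdge y q = some e := by
  obtain ⟨α, hα⟩ := exists_isPrefix hq
  obtain ⟨z, hz⟩ := exists_bRange_eq G (G.s e)
  obtain ⟨z', hz', -⟩ := exists_cons_boundaryPath e z hz.symm
  obtain ⟨y, hy, hyz⟩ := exists_concat α z'
    (by rw [hα.pathSource_eq, he, bRange_of_bEdge_zero hz'])
  refine ⟨y, hy.1.symm.trans hα.1, fun i hi => (hy.2 i hi).trans (hα.2 i hi).symm, ?_⟩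
  rw [← hz', ← hyz, bEdge_shift_iter, add_zero]

theorem exists_levelCyl_shift_iter_eq [T2Space V] [T2Space E] (hV : TotallyDisc V)
    (hcf : G.Cofinal) {x : G.BoundaryPath} (hx : ∀ m : ℕ, (m : ℕ∞) ≤ G.bLen x) {n : ℕ}
    (hxn : G.shift^[n + 1] x = x) {O : Set G.BoundaryPath} (hO : IsOpen O) (hne : O.Nonempty)
    (c₀ : ℕ) : ∃ c ≥ c₀, ∃ (A : Set (G.PathN c)) (y : G.BoundaryPath), IsOpen A ∧
      y ∈ levelCyl c A ∧ levelCyl c A ⊆ O ∧ G.shift^[c] y = x := by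
  obtain ⟨y, hyO, k, l, hk, hl, hkl⟩ := exists_shift_iter_eq_of_cofinal hV hcf x hO hne
  have hy : ∀ m : ℕ, (m : ℕ∞) ≤ G.bLen y := fun m =>
    le_bLen_mono (Nat.le_add_left m k) (add_le_bLen_iff.2 ⟨hk, by
      rw [hkl]; exact (add_le_bLen_iff.1 (hx (l + m))).2⟩)
  obtain ⟨m₀, hm⟩ := exists_levelCyl_subset_of_infinite hy (hO.mem_nhds hyO)
  have h1 : m₀ + c₀ ≤ (n + 1) * (m₀ + c₀) := Nat.le_mul_of_pos_left _ n.succ_pos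
  obtain ⟨A, hA, hyA, hAO⟩ := hm (l * n + (n + 1) * (m₀ + c₀) + k) (by omega)
  refine ⟨_, by omega, A, y, hA, hyA, hAO, ?_⟩
  rw [Function.iterate_add_apply, hkl, ← Function.iterate_add_apply,
    show l * n + (n + 1) * (m₀ + c₀) + l = (n + 1) * (m₀ + c₀ + l) by ring]
  exact shift_iter_mul_of_shift_iter_eq hxn _

theorem isOpen_bEdge_mem [T2Space V] [T2Space E] [LocallyCompactSpace E] (q : ℕ) {O : Set E}
    (hO : IsOpen O) : IsOpen {x : G.BoundaryPath | ∃ e ∈ O, G.bEdge x q = some e} := by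
  convert isOpen_inter_shift_iter_preimage (isOpen_le_bLen q) (fun x hx => hx)
    (isOpen_bEdge_zero_mem (G := G) hO) using 1
  ext x
  simp only [mem_inter_iff, mem_preimage, mem_ofPred_eq, bEdge_shift_iter, add_zero]
  refine ⟨fun h => ⟨?_, h⟩, And.right⟩
  obtain ⟨e, -, he⟩ := h
  exact le_bLen_mono q.le_succ (succ_le_bLen_iff.2 (by rw [he]; simp))

/-! ### Essential freeness -/

theorem exists_open_disjoint_shift_iter_eq [T2Space V] [T2Space E] [LocallyCompactSpace E]
    (hV : TotallyDisc V) (hcf : G.Cofinal) {n : ℕ} {γ : G.PathN (n + 1)} (hγ : G.IsCycle n γ)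
    (hent : G.HasEntrances n γ) {k l : ℕ} (hlk : l < k) {O : Set G.BoundaryPath} (hO : IsOpen O)
    (hne : O.Nonempty) : ∃ W : Set G.BoundaryPath, IsOpen W ∧ W.Nonempty ∧ W ⊆ O ∧
      ∀ x ∈ W, G.shift^[k] x ≠ G.shift^[l] x := by
  obtain ⟨x, hx, hxr, hxe, hxn⟩ := exists_infinite_path_of_isCycle hγ
  simp only [HasEntrances, NoEntrances, not_forall] at hent
  obtain ⟨j, e, her, hej⟩ := hent
  obtain ⟨c, hc, A, y, hA, hyA, hAO, hy⟩ :=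
    exists_levelCyl_shift_iter_eq hV hcf hx hxn hO hne k
  have hyj : G.bEdge y (c + j) = some (γ.1 j) := by
    rw [← bEdge_shift_iter, hy, hxe]
  have hyq : ((c + j : ℕ) : ℕ∞) ≤ G.bLen y :=
    le_bLen_mono (c + j).le_succ (succ_le_bLen_iff.2 (by rw [hyj]; simp))
  obtain ⟨i, hi⟩ := Nat.exists_eq_add_of_le (show k ≤ c + j by omega)
  obtain ⟨z, hzA, e₁, e₂, h1, h2, h12⟩ : ∃ z ∈ levelCyl c A, ∃ e₁ e₂,
      G.bEdge z (k + i) = some e₁ ∧ G.bEdge z (l + i) = some e₂ ∧ e₁ ≠ e₂ := by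
    obtain ⟨e₂, he₂⟩ := Option.ne_none_iff_exists'.1
      (le_bLen_iff.1 hyq (l + i) (by omega))
    rw [hi] at hyj hyq
    by_cases he : e₂ = γ.1 j
    · obtain ⟨z, hz1, hz2, hz3⟩ := exists_deviating_path (e := e) hyq
        (by rw [bRange_shift_iter hyj, her])
      refine ⟨z, mem_levelCyl_of_agree hyA hz1 fun t ht => hz2 t (by omega), e, e₂, hz3, ?_, ?_⟩
      · rw [hz2 _ (by omega), he₂]
      · rw [he]; exact hej
    · exact ⟨y, hyA, _, e₂, hyj, he₂, fun h => he h.symm⟩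
  obtain ⟨O₁, O₂, hO₁, hO₂, he₁, he₂, hd⟩ := t2_separation h12
  refine ⟨O ∩ ({x | ∃ e ∈ O₁, G.bEdge x (k + i) = some e} ∩
    {x | ∃ e ∈ O₂, G.bEdge x (l + i) = some e}), hO.inter ((isOpen_bEdge_mem _ hO₁).inter
      (isOpen_bEdge_mem _ hO₂)), ⟨z, hAO hzA, ⟨e₁, he₁, h1⟩, ⟨e₂, he₂, h2⟩⟩, inter_subset_left, ?_⟩
  rintro x ⟨-, ⟨a, ha, hxa⟩, ⟨b, hb, hxb⟩⟩ h
  rw [← bEdge_shift_iter, h, bEdge_shift_iter, hxb, Option.some_inj] at hxa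
  exact disjoint_left.1 hd ha (hxa ▸ hb)

theorem essentiallyFree_of_cycle [T2Space V] [T2Space E] [LocallyCompactSpace V]
    [LocallyCompactSpace E] (hV : TotallyDisc V) (hE : TotallyDisc E) (hcf : G.Cofinal) {n : ℕ}
    {γ : G.PathN (n + 1)} (hγ : G.IsCycle n γ) (hent : G.HasEntrances n γ) :
    G.EssentiallyFree := by
  have := totallySeparatedSpace_boundaryPath (G := G) hV hE
  have := locallyCompactSpace_boundaryPath (G := G) hV hE
  have hd : Dense (⋂ p : {p : ℕ × ℕ // p.2 < p.1},
      interior {x : G.BoundaryPath | G.shift^[p.1.1] x ≠ G.shift^[p.1.2] x}) := by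
    refine dense_iInter_of_isOpen (fun p => isOpen_interior) fun p => ?_
    refine dense_iff_inter_open.2 fun O hO hne => ?_
    obtain ⟨W, hW, ⟨x, hx⟩, hWO, h⟩ :=
      exists_open_disjoint_shift_iter_eq hV hcf hγ hent p.2 hO hne
    exact ⟨x, hWO hx, mem_interior.2 ⟨W, h, hW, hx⟩⟩
  refine hd.mono fun x hx m hm => ?_
  rw [mem_iInter] at hx
  obtain ⟨k, l, rfl, -, -, h⟩ := hm
  rcases lt_trichotomy k l with hkl | rfl | hkl
  · exact absurd h.symm (interior_subset (hx ⟨(l, k), hkl⟩))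
  · simp
  · exact absurd h (interior_subset (hx ⟨(k, l), hkl⟩))

/-! ### Infinitely many disjoint copies of an open set -/

/-- The boundary paths with initial segment in `S` followed by a boundary path in `T`. -/
def prepend {m : ℕ} (S : Set (G.PathN m)) (T : Set G.BoundaryPath) : Set G.BoundaryPath :=
  levelCyl m S ∩ G.shift^[m] ⁻¹' T

theorem isOpen_prepend [T2Space V] [T2Space E] [LocallyCompactSpace E] {m : ℕ}
    {S : Set (G.PathN m)} {T : Set G.BoundaryPath} (hS : IsOpen S) (hT : IsOpen T) :
    IsOpen (prepend S T) :=
  isOpen_inter_shift_iter_preimage (isOpen_levelCyl hS)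
    (fun _ hx => le_bLen_of_mem_levelCyl hx) hT

/-- The iterated shift `σ^b` is defined and injective on `T`, and maps `T` onto a set
containing `Q`, with preimages having ranges in `N`. -/
structure ShiftCovers (G : TopGraph V E) (b : ℕ) (T Q : Set G.BoundaryPath) (N : Set V) :
    Prop where
  le_bLen : ∀ x ∈ T, (b : ℕ∞) ≤ G.bLen x
  injOn : InjOn (G.shift^[b]) T
  exists_eq : ∀ z ∈ Q, ∃ x ∈ T, G.shift^[b] x = z ∧ G.bRange x ∈ N

theorem shiftCovers_levelCyl {p : ℕ} {R : Set (G.PathN p)} (hR : InjOn (G.pathSource p) R) :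
    ShiftCovers G p (levelCyl p R) (levelCyl 0 (G.pathSource p '' R : Set V))
      (G.pathRange p '' R) where
  le_bLen _ hx := le_bLen_of_mem_levelCyl hx
  injOn := injOn_shift_iter_levelCyl hR
  exists_eq z hz := by
    obtain ⟨ρ, hρ, h⟩ := mem_levelCyl_zero.1 hz
    obtain ⟨x, hx, hxz⟩ := exists_concat ρ z h
    exact ⟨x, ⟨ρ, hρ, hx⟩, hxz, ρ, hρ, hx.1⟩

theorem ShiftCovers.prepend {m b : ℕ} {S : Set (G.PathN m)} {T Q : Set G.BoundaryPath}
    {N : Set V} (h : ShiftCovers G b T Q N) (hS : InjOn (G.pathSource m) S)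
    (hN : N ⊆ G.pathSource m '' S) :
    ShiftCovers G (b + m) (prepend S T) Q (G.pathRange m '' S) where
  le_bLen x hx := by
    rw [add_comm]
    exact add_le_bLen_iff.2 ⟨le_bLen_of_mem_levelCyl hx.1, h.le_bLen _ hx.2⟩
  injOn x hx y hy hxy := by
    rw [Function.iterate_add_apply, Function.iterate_add_apply] at hxy
    exact injOn_shift_iter_levelCyl hS hx.1 hy.1 (h.injOn hx.2 hy.2 hxy)
  exists_eq z hz := by
    obtain ⟨x, hx, hxz, hxN⟩ := h.exists_eq z hz
    obtain ⟨α, hα, hαx⟩ := hN hxN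
    obtain ⟨y, hy, hyx⟩ := exists_concat α x hαx
    refine ⟨y, ⟨⟨α, hα, hy⟩, ?_⟩, ?_, α, hα, hy.1⟩
    · rw [mem_preimage, hyx]
      exact hx
    · rw [Function.iterate_add_apply, hyx, hxz]

theorem ShiftCovers.mono {b : ℕ} {T Q : Set G.BoundaryPath} {N N' : Set V}
    (h : ShiftCovers G b T Q N) (hN : N ⊆ N') : ShiftCovers G b T Q N' :=
  ⟨h.le_bLen, h.injOn, fun z hz =>
    let ⟨x, hx, hxz, hxN⟩ := h.exists_eq z hz
    ⟨x, hx, hxz, hN hxN⟩⟩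

/-- The boundary paths starting with `i` paths in `U` followed by a path in `R`. -/
def tower {p w : ℕ} (R : Set (G.PathN p)) (U : Set (G.PathN w)) : ℕ → Set G.BoundaryPath
  | 0 => levelCyl p R
  | i + 1 => prepend U (tower R U i)

theorem isOpen_tower [T2Space V] [T2Space E] [LocallyCompactSpace E] {p w : ℕ}
    {R : Set (G.PathN p)} {U : Set (G.PathN w)} (hR : IsOpen R) (hU : IsOpen U) :
    ∀ i, IsOpen (tower R U i)
  | 0 => isOpen_levelCyl hR
  | i + 1 => isOpen_prepend hU (isOpen_tower hR hU i)

theorem shiftCovers_tower {p w : ℕ} {R : Set (G.PathN p)} {U : Set (G.PathN w)}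
    (hR : InjOn (G.pathSource p) R) (hU : InjOn (G.pathSource w) U)
    (hRU : G.pathRange p '' R ⊆ G.pathSource w '' U)
    (hUU : G.pathRange w '' U ⊆ G.pathSource w '' U) (i : ℕ) :
    ShiftCovers G (p + w * i) (tower R U i) (levelCyl 0 (G.pathSource p '' R : Set V))
      (G.pathSource w '' U) := by
  induction i with
  | zero => exact (shiftCovers_levelCyl hR).mono hRU
  | succ i ih =>
    rw [mul_add, mul_one, ← add_assoc]
    exact (ih.prepend hU subset_rfl).mono hUU

theorem eq_of_mem_tower {p w j : ℕ} {R : Set (G.PathN p)} {U : Set (G.PathN w)} {O₁ O₂ : Set E}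
    (hd : Disjoint O₁ O₂) (hjp : j < p) (hjw : j < w)
    (hR : ∀ ρ ∈ R, ∀ e, G.pathEdge p ρ j = some e → e ∈ O₁)
    (hU : ∀ μ ∈ U, ∀ e, G.pathEdge w μ j = some e → e ∈ O₂) (i i' : ℕ) (x : G.BoundaryPath)
    (hx : x ∈ tower R U i) (hx' : x ∈ tower R U i') : i = i' := by
  have key : ∀ {i x}, x ∈ tower R U 0 → x ∉ tower R U (i + 1) := by
    rintro i x ⟨ρ, hρ, h⟩ ⟨⟨μ, hμ, h'⟩, -⟩
    obtain ⟨e, he⟩ := Option.ne_none_iff_exists'.1 ((pathEdge_ne_none ρ).2 hjp)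
    refine disjoint_left.1 hd (hR ρ hρ e he) (hU μ hμ e ?_)
    rw [← h'.2 j hjw, h.2 j hjp, he]
  induction i generalizing i' x with
  | zero =>
    cases i' with
    | zero => rfl
    | succ i' => exact absurd hx' (key hx)
  | succ i ih =>
    cases i' with
    | zero => exact absurd hx (key hx')
    | succ i' => rw [ih _ _ hx.2 hx'.2]

theorem exists_disjoint_shiftCovers [T2Space V] [T2Space E] [LocallyCompactSpace E] {n : ℕ}
    {γ : G.PathN (n + 1)} (hγ : G.IsCycle n γ) (hent : G.HasEntrances n γ)
    (hcon : G.NbhdContracting n γ) {c : ℕ} {B : Set (G.PathN c)} (hB : IsOpen B)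
    (hBi : InjOn (G.pathSource c) B) (hγB : G.pathRange (n + 1) γ ∈ G.pathSource c '' B) :
    ∃ (Q : Set G.BoundaryPath) (A : ℕ → Set G.BoundaryPath) (a : ℕ → ℕ),
      IsOpen Q ∧ Q.Nonempty ∧ (∀ i, IsOpen (A i)) ∧ (∀ i, A i ⊆ levelCyl c B) ∧
      (∀ i, ShiftCovers G (a i) (A i) Q univ) ∧
      ∀ i j x, x ∈ A i → x ∈ A j → i = j := by
  obtain ⟨x, hx, hxr, hxe, -⟩ := exists_infinite_path_of_isCycle hγ
  simp only [HasEntrances, NoEntrances, not_forall] at hent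
  obtain ⟨j, e, her, hej⟩ := hent
  obtain ⟨O₁, O₂, hO₁, hO₂, he₁, he₂, hd⟩ := t2_separation hej
  obtain ⟨I, hI, hγI, hIi⟩ := exists_open_injOn_pathSource γ
  obtain ⟨U, hU, hγU, hUN, hUU⟩ := hcon
    (G.pathSource (n + 1) ⁻¹' (G.pathSource c '' B) ∩ (I ∩ (fun μ => μ.1 j) ⁻¹' O₂))
    (((isOpen_image_pathSource hB).preimage (continuous_pathSource _)).inter
      (hI.inter (hO₂.preimage (continuous_pathN_edge j)))) ⟨by rwa [mem_preimage, ← hγ], hγI, he₂⟩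
  obtain ⟨y, hyr, -, hye⟩ := exists_deviating_path (e := e) (hx j)
    (by rw [bRange_shift_iter (hxe j), her])
  obtain ⟨ρ, hρ⟩ := exists_isPrefix (n := j + 1) (x := y)
    (succ_le_bLen_iff.2 (by rw [hye]; simp))
  obtain ⟨R', hR', hρR', hRi⟩ := exists_open_injOn_pathSource ρ
  set R := R' ∩ (G.pathRange (j + 1) ⁻¹' (G.pathSource (n + 1) '' U) ∩
    (fun ρ => ρ.1 ⟨j, Nat.lt_succ_self j⟩) ⁻¹' O₁) with hRdef
  have hR : IsOpen R := hR'.inter (((isOpen_image_pathSource hU).preimage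
    (continuous_pathRange _)).inter (hO₁.preimage (continuous_pathN_edge _)))
  have hρR : ρ ∈ R := by
    refine ⟨hρR', ?_, ?_⟩
    · rw [mem_preimage, hρ.1, hyr, hxr, hγ]
      exact mem_image_of_mem _ hγU
    · have h := hρ.2 j (Nat.lt_succ_self _)
      rw [hye] at h
      simp only [pathEdge, Nat.lt_succ_self, dif_pos, Option.some_inj] at h
      rw [mem_preimage, ← h]
      exact he₁
  have hcov := shiftCovers_tower (R := R) (hRi.mono inter_subset_left)
    (hIi.mono fun μ hμ => (hUN hμ).2.1) (image_subset_iff.2 fun ρ hρ => hρ.2.1) hUU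
  refine ⟨levelCyl 0 (G.pathSource (j + 1) '' R : Set V), fun i => prepend B (tower R U i), _,
    isOpen_levelCyl (isOpen_image_pathSource hR), ⟨G.shift^[j + 1] y, ?_⟩,
    fun i => isOpen_prepend hB (isOpen_tower hR hU i), fun i => inter_subset_left,
    fun i => ((hcov i).prepend hBi (image_subset_iff.2 fun μ hμ => (hUN hμ).1)).mono
      (subset_univ _), fun i i' x hx hx' => ?_⟩
  · exact mem_levelCyl_zero.2 ⟨ρ, hρR, hρ.pathSource_eq⟩
  · refine eq_of_mem_tower hd (Nat.lt_succ_self j) j.2 (fun ρ hρ e he => ?_)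
      (fun μ hμ e he => ?_) i i' _ hx.2 hx'.2
    · simp only [pathEdge, Nat.lt_succ_self, dif_pos, Option.some_inj] at he
      exact he ▸ hρ.2.2
    · simp only [pathEdge, j.2, dif_pos, Option.some_inj] at he
      exact he ▸ (hUN hμ).2.2

/-! ### Local contraction -/

theorem exists_contracting_bisection [T2Space V] [T2Space E] [LocallyCompactSpace V]
    [LocallyCompactSpace E] (hV : TotallyDisc V) (hE : TotallyDisc E) (hcf : G.Cofinal)
    {K Q : Set G.BoundaryPath} (hK : IsCompact K) (hKc : IsClosed K) (hQ : IsOpen Q)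
    (hQne : Q.Nonempty) {A : ℕ → Set G.BoundaryPath} {a : ℕ → ℕ} (hA : ∀ i, IsOpen (A i))
    (hAK : ∀ i, A i ⊆ K) (hcov : ∀ i, ShiftCovers G (a i) (A i) Q univ)
    (hdisj : ∀ i j x, x ∈ A i → x ∈ A j → i = j) :
    ∃ N : Set G.BPGroupoid, IsOpen N ∧ G.IsBisection N ∧ closure K ⊆ G.gS '' N ∧
      G.gR '' (N ∩ {x | G.gS x ∈ closure K}) ⊂ K := by
  have local_data : ∀ x : G.BoundaryPath, ∃ (W D : Set G.BoundaryPath) (k l : ℕ),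
      IsOpen W ∧ W ⊆ Q ∧ (∀ y ∈ W, (k : ℕ∞) ≤ G.bLen y) ∧ InjOn (G.shift^[k]) W ∧
      IsClopen D ∧ x ∈ D ∧ (∀ y ∈ D, (l : ℕ∞) ≤ G.bLen y) ∧ InjOn (G.shift^[l]) D ∧
      ∀ y ∈ D, ∃ z ∈ W, G.shift^[k] z = G.shift^[l] y := by
    intro x
    obtain ⟨y, hy, k, l, hk, hl, hkl⟩ := exists_shift_iter_eq_of_cofinal hV hcf x hQ hQne
    obtain ⟨P, hP, hyP, hPk, hPi⟩ := exists_open_injOn_shift_iter hk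
    obtain ⟨P', hP', hxP', hPl, hPi'⟩ := exists_open_injOn_shift_iter hl
    have h1 : G.shift^[k] '' (P ∩ Q) ∈ 𝓝 (G.shift^[l] x) := by
      rw [← hkl, ← map_shift_iter_nhds hk]
      exact image_mem_map ((hP.inter hQ).mem_nhds ⟨hyP, hy⟩)
    obtain ⟨D, hD, hxD, hDP⟩ := exists_isClopen_subset hV hE
      (inter_mem (hP'.mem_nhds hxP') (continuousAt_shift_iter hl h1))
    exact ⟨P ∩ Q, D, k, l, hP.inter hQ, inter_subset_right, fun y hy => hPk y hy.1,
      hPi.mono inter_subset_left, hD, hxD, fun y hy => hPl y (hDP hy).1,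
      hPi'.mono fun y hy => (hDP hy).1, fun y hy => (hDP hy).2⟩
  choose W D k l hW hWQ hWk hWi hD hxD hDl hDi hDW using local_data
  obtain ⟨z₀, hz₀⟩ := hQne
  obtain ⟨x₀, hx₀, -⟩ := (hcov 0).exists_eq z₀ hz₀
  obtain ⟨t, ht, hKt⟩ := hK.elim_nhds_subcover D fun x _ => (hD x).isOpen.mem_nhds (hxD x)
  have htne : (t : Set G.BoundaryPath).Nonempty := by
    obtain ⟨x, hx, -⟩ := mem_iUnion₂.1 (hKt (hAK 0 hx₀))
    exact ⟨x, hx⟩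
  obtain ⟨f, hf⟩ := t.countable_toSet.exists_eq_range htne
  have hcover : ∀ x ∈ K, ∃ i, x ∈ disjointed (fun i => D (f i)) i := by
    intro x hx
    obtain ⟨y, hy, hxy⟩ := mem_iUnion₂.1 (hKt hx)
    obtain ⟨i, rfl⟩ : y ∈ range f := hf ▸ hy
    rw [← mem_iUnion, iUnion_disjointed]
    exact mem_iUnion.2 ⟨i, hxy⟩
  have hle : ∀ i, disjointed (fun i => D (f i)) i ⊆ D (f i) := fun i => disjointed_subset _ i
  have hopen : ∀ i, IsClopen (disjointed (fun i => D (f i)) i) := fun i =>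
    disjointedRec (p := IsClopen) (fun _ j h => h.diff (hD (f j))) (hD (f i))
  set A' : ℕ → Set G.BoundaryPath := fun i => A (i + 1) ∩ G.shift^[a (i + 1)] ⁻¹' W (f i) with hA'
  have hAo : ∀ i, IsOpen (A' i) := fun i =>
    isOpen_inter_shift_iter_preimage (hA _) (hcov _).le_bLen (hW _)
  have hAk : ∀ i, ∀ x ∈ A' i, ((k (f i) + a (i + 1) : ℕ) : ℕ∞) ≤ G.bLen x := fun i x hx => by
    rw [add_comm]
    exact add_le_bLen_iff.2 ⟨(hcov _).le_bLen x hx.1, hWk _ _ hx.2⟩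
  have hAi : ∀ i, InjOn (G.shift^[k (f i) + a (i + 1)]) (A' i) := by
    intro i x hx y hy h
    rw [Function.iterate_add_apply, Function.iterate_add_apply] at h
    exact (hcov _).injOn hx.1 hy.1 (hWi _ hx.2 hy.2 h)
  have hDi' := fun i => (hDi (f i)).mono (hle i)
  have hDl' := fun i x hx => hDl (f i) x (hle i hx)
  refine ⟨⋃ i, basicSet (A' i) (disjointed (fun i => D (f i)) i) (k (f i) + a (i + 1)) (l (f i)),
    isOpen_iUnion fun i => isOpen_basicSet (hAo i) (hopen i).isOpen (hAk i) (hDl' i) (hAi i)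
      (hDi' i),
    isBisection_iUnion_basicSet hAo (fun i => (hopen i).isOpen) hAk hDl' hAi hDi'
      (fun i j x hx hx' => Nat.succ_injective (hdisj _ _ x hx.1 hx'.1))
      (fun i j x hx hx' => by
        by_contra hij
        exact disjoint_left.1 (disjoint_disjointed _ hij) hx hx'), ?_, ?_⟩
  · rw [hKc.closure_eq]
    intro x hx
    obtain ⟨i, hi⟩ := hcover x hx
    obtain ⟨y, hy, hyx⟩ := hDW _ _ (hle i hi)
    obtain ⟨z, hz, hzy, -⟩ := (hcov (i + 1)).exists_eq y (hWQ _ hy)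
    have hzx : G.shift^[k (f i) + a (i + 1)] z = G.shift^[l (f i)] x := by
      rw [Function.iterate_add_apply, hzy, hyx]
    have hzA : z ∈ A' i := ⟨hz, by rw [mem_preimage, hzy]; exact hy⟩
    exact ⟨⟨(z, ((k (f i) + a (i + 1) : ℕ) : ℤ) - (l (f i) : ℤ), x),
      _, _, rfl, hAk i z hzA, hDl' i x hi, hzx⟩, mem_iUnion.2 ⟨i, hzA, hi, rfl, hzx⟩, rfl⟩
  · refine (ssubset_iff_of_subset ?_).2 ⟨x₀, hAK 0 hx₀, ?_⟩
    · rintro _ ⟨g, ⟨hg, -⟩, rfl⟩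
      obtain ⟨i, hi⟩ := mem_iUnion.1 hg
      exact hAK _ hi.1.1
    · rintro ⟨g, ⟨hg, -⟩, rfl⟩
      obtain ⟨i, hi⟩ := mem_iUnion.1 hg
      exact absurd (hdisj _ _ _ hx₀ hi.1.1) (by omega)

theorem locallyContracting_of_cycle [T2Space V] [T2Space E] [LocallyCompactSpace V]
    [LocallyCompactSpace E] (hV : TotallyDisc V) (hE : TotallyDisc E) (hcf : G.Cofinal) {n : ℕ}
    {γ : G.PathN (n + 1)} (hγ : G.IsCycle n γ) (hent : G.HasEntrances n γ)
    (hcon : G.NbhdContracting n γ) : G.BPLocallyContracting := by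
  intro O hO hne
  obtain ⟨x, hx, hxr, -, hxn⟩ := exists_infinite_path_of_isCycle hγ
  obtain ⟨c, -, A, y, hA, ⟨β, hβA, hβ⟩, hAO, hy⟩ :=
    exists_levelCyl_shift_iter_eq hV hcf hx hxn hO hne 0
  obtain ⟨I, hI, hβI, hIi⟩ := exists_open_injOn_pathSource β
  obtain ⟨B, hBc, hB, hβB, hBA⟩ := totallyDisc_pathN hV hE c β _ (hA.inter hI) ⟨hβA, hβI⟩
  obtain ⟨Q, T, a, hQ, hQne, hT, hTB, hcov, hdisj⟩ :=
    exists_disjoint_shiftCovers hγ hent hcon hB (hIi.mono fun α hα => (hBA hα).2)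
      ⟨β, hβB, by rw [hβ.pathSource_eq, hy, hxr]⟩
  obtain ⟨N, hN, hNb, h1, h2⟩ := exists_contracting_bisection hV hE hcf
    (isCompact_levelCyl hBc) (isClosed_levelCyl hBc) hQ hQne hT hTB hcov hdisj
  exact ⟨levelCyl c B, N, isOpen_levelCyl hB,
    (levelCyl_mono fun α hα => (hBA hα).1).trans hAO, hN, hNb, h1, h2⟩

end

end TopGraph

/-- Corollary 3.12: let `E` be a totally disconnected topological graph
which is topologically free and cofinal (equivalently, `𝒪(E)` is simple). If there is a
cycle `μ` with entrances such that every open neighborhood of `μ` in `E^{|μ|}` contains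
an open neighborhood `U` of `μ` with `r^{|μ|}(U) ⊆ s^{|μ|}(U)`, then `E` is essentially
free and the boundary path groupoid `Γ(∂E, σ)` is locally contracting. -/
theorem TopGraph.essentiallyFree_and_locallyContracting_of_cycle {V E : Type}
    [TopologicalSpace V] [TopologicalSpace E]
    [SecondCountableTopology V] [SecondCountableTopology E]
    [LocallyCompactSpace V] [LocallyCompactSpace E] [T2Space V] [T2Space E]
    (G : TopGraph V E) (hV : TotallyDisc V) (hE : TotallyDisc E)
    (htf : G.TopologicallyFree) (hcf : G.Cofinal)
    (hcycle : ∃ (n : ℕ) (μ : G.PathN (n + 1)),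
      G.IsCycle n μ ∧ G.HasEntrances n μ ∧ G.NbhdContracting n μ) :
    G.EssentiallyFree ∧ G.BPLocallyContracting := by
  obtain ⟨n, γ, hγ, hent, hcon⟩ := hcycle
  exact ⟨essentiallyFree_of_cycle hV hE hcf hγ hent,
    locallyContracting_of_cycle hV hE hcf hγ hent hcon⟩
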